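/- arXiv:1701.02762 — 2 statements merged into one kernel-verified Lean document; each statement's English description precedes it below -/
import Mathlib

section
/- Let n ≥ 3 and let S ⊆ ℝⁿ be a set of positive Lebesgue (outer) measure. If B ⊆ ℝⁿ contains a sphere centered at every point of S, i.e. for every x ∈ S there exists r > 0 with Metric.sphere x r ⊆ B, then B has positive Lebesgue (outer) measure. (Stein's theorem.) -/
open MeasureTheory Metric

lemma st_pow (k : ℕ) {A B M : ℝ} (hB : 0 ≤ B) (hBA : B ≤ A) (hAM : A ≤ M) :
    A ^ (k + 2) - B ^ (k + 2) ≤ (k + 1) * M ^ k * (A ^ 2 - B ^ 2) := by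
  induction k with
  | zero => simp
  | succ k ih =>
    have hM : 0 ≤ M := by linarith
    have hA : 0 ≤ A := by linarith
    have h0 : 0 ≤ A ^ 2 - B ^ 2 := by nlinarith
    have h1 : A ^ (k + 3) - B ^ (k + 3) = A * (A ^ (k + 2) - B ^ (k + 2)) + B ^ (k + 1) * (B * (A - B)) := by
      ring
    have h2 : A * (A ^ (k + 2) - B ^ (k + 2)) ≤ M * ((k + 1) * M ^ k * (A ^ 2 - B ^ 2)) := by
      refine mul_le_mul hAM ih ?_ hM
      exact sub_nonneg.2 (pow_le_pow_left₀ hB hBA _)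
    have h3 : B ^ (k + 1) * (B * (A - B)) ≤ M ^ (k + 1) * (A ^ 2 - B ^ 2) := by
      refine mul_le_mul (pow_le_pow_left₀ hB (hBA.trans hAM) _) (by nlinarith) (by nlinarith) (by positivity)
    rw [show k + 1 + 2 = k + 3 from rfl, h1]
    push_cast
    calc _ ≤ _ := add_le_add h2 h3
      _ = _ := by ring

lemma st_ann (n : ℕ) (hn : 0 < n) (x : EuclideanSpace ℝ (Fin n)) {A B : ℝ} (hA : 0 ≤ A) (hAB : A ≤ B) :
    volume (ball x B \ ball x A) =
      ENNReal.ofReal (B ^ n - A ^ n) * volume (ball (0 : EuclideanSpace ℝ (Fin n)) 1) := by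
  have : NeZero n := ⟨hn.ne'⟩
  have : Nontrivial (EuclideanSpace ℝ (Fin n)) := by
    apply Module.nontrivial_of_finrank_pos (R := ℝ); simpa using hn
  rw [measure_sdiff (ball_subset_ball hAB) measurableSet_ball.nullMeasurableSet measure_ball_lt_top.ne,
    Measure.addHaar_ball _ _ hA, Measure.addHaar_ball _ _ (hA.trans hAB), finrank_euclideanSpace_fin,
    ENNReal.ofReal_sub _ (by positivity), ENNReal.sub_mul]
  intros; exact measure_ball_lt_top.ne

lemma st_window (k : ℕ) {t η M : ℝ} (hη : 0 ≤ η) (hM : 0 ≤ M) (h : t + η ≤ M ^ 2) :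
    volume {q : EuclideanSpace ℝ (Fin (k + 2)) | t ≤ ‖q‖ ^ 2 ∧ ‖q‖ ^ 2 < t + η} ≤
      ENNReal.ofReal ((k + 1) * M ^ k * η) * volume (ball (0 : EuclideanSpace ℝ (Fin (k + 2))) 1) := by
  have hA : √(t + η) ≤ M := by
    rw [← Real.sqrt_sq hM]; exact Real.sqrt_le_sqrt h
  have hBA : √t ≤ √(t + η) := Real.sqrt_le_sqrt (by linarith)
  calc _ ≤ volume (ball (0 : EuclideanSpace ℝ (Fin (k + 2))) (√(t + η)) \ ball 0 (√t)) := by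
        apply measure_mono
        rintro q ⟨h1, h2⟩
        simp only [Set.mem_sdiff, mem_ball, dist_zero_right, not_lt]
        exact ⟨Real.lt_sqrt_of_sq_lt h2, Real.sqrt_le_iff.2 ⟨norm_nonneg _, h1⟩⟩
    _ = _ := st_ann _ (by omega) _ (Real.sqrt_nonneg _) hBA
    _ ≤ _ := by
        gcongr
        refine (st_pow k (Real.sqrt_nonneg _) hBA hA).trans ?_
        refine mul_le_mul_of_nonneg_left ?_ (by positivity)
        rcases le_total 0 t with ht | ht
        · rw [Real.sq_sqrt ht, Real.sq_sqrt (by linarith)]; linarith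
        · rw [Real.sqrt_eq_zero_of_nonpos ht]
          rcases le_total 0 (t + η) with h' | h'
          · rw [Real.sq_sqrt h']; linarith
          · rw [Real.sqrt_eq_zero_of_nonpos h']; linarith

lemma st_split (m : ℕ) (u : EuclideanSpace ℝ (Fin (m + 1))) (hu : ‖u‖ = 1) :
    ∃ e : EuclideanSpace ℝ (Fin (m + 1)) → ℝ × EuclideanSpace ℝ (Fin m),
      MeasurePreserving e ∧ ∀ p, (e p).1 = inner ℝ u p ∧ ‖p‖ ^ 2 = (e p).1 ^ 2 + ‖(e p).2‖ ^ 2 := by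
  have hv : Orthonormal ℝ (({0} : Set (Fin (m + 1))).domRestrict (fun _ => u)) := by
    constructor
    · intro i; simpa using hu
    · intro i j hij; exact absurd (Subsingleton.elim i j) hij
  obtain ⟨b, hb⟩ := hv.exists_orthonormalBasis_extension_of_card_eq (by simp)
  have hb0 : b 0 = u := hb 0 rfl
  have h1 := b.measurePreserving_repr
  have h2 := PiLp.volume_preserving_ofLp (Fin (m + 1))
  have h3 := volume_preserving_piFinSuccAbove (fun _ : Fin (m + 1) => ℝ) 0
  have h4 : MeasurePreserving (Prod.map id (@WithLp.toLp 2 (Fin m → ℝ)) :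
      ℝ × (Fin m → ℝ) → ℝ × EuclideanSpace ℝ (Fin m)) volume volume :=
    (MeasurePreserving.id (volume : Measure ℝ)).prod (PiLp.volume_preserving_toLp (Fin m))
  refine ⟨_, h4.comp (h3.comp (h2.comp h1)), fun p => ⟨?_, ?_⟩⟩
  · simp [← hb0, ← b.repr_apply_apply, MeasurableEquiv.piFinSuccAbove]
  · rw [← b.repr.norm_map p]
    rw [EuclideanSpace.norm_sq_eq, EuclideanSpace.norm_sq_eq, Fin.sum_univ_succ]
    simp [MeasurableEquiv.piFinSuccAbove, Fin.tail]

lemma st_inter (k : ℕ) {a b δ r s : ℝ} (ha : 0 < a) (hr : r ∈ Set.Icc a b) (hs : s ∈ Set.Icc a b)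
    (hδ : 0 < δ) (hδ1 : δ ≤ 1) (x y : EuclideanSpace ℝ (Fin (k + 3))) (hxy : x ≠ y) :
    volume ((ball x (r + δ) \ ball x r) ∩ (ball y (s + δ) \ ball y s)) ≤
      ENNReal.ofReal ((k + 1) * (b + 1) ^ k * (2 * b + 1) ^ 2) *
        volume (ball (0 : EuclideanSpace ℝ (Fin (k + 2))) 1) * ENNReal.ofReal (δ ^ 2) *
        ENNReal.ofReal (‖x - y‖⁻¹) := by
  obtain ⟨hr1, hr2⟩ := hr
  obtain ⟨hs1, hs2⟩ := hs
  have hb : 0 < b := by linarith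
  set d := ‖y - x‖ with hd
  have hd0 : 0 < d := norm_pos_iff.2 (sub_ne_zero.2 hxy.symm)
  obtain ⟨e, he, hep⟩ := st_split (k + 2) (d⁻¹ • (y - x)) (by
    rw [norm_smul, ← hd, norm_inv, Real.norm_of_nonneg hd0.le, inv_mul_cancel₀ hd0.ne'])
  set η := (2 * b + 1) * δ with hη
  have hη0 : 0 < η := by positivity
  have hηr : (r + δ) ^ 2 ≤ r ^ 2 + η := by nlinarith
  have hηs : (s + δ) ^ 2 ≤ s ^ 2 + η := by nlinarith
  set α := (r ^ 2 + d ^ 2 - s ^ 2 - η) / (2 * d) with hα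
  set T : Set (ℝ × EuclideanSpace ℝ (Fin (k + 2))) :=
    {w | w.1 ∈ Set.Icc α (α + η / d) ∧ (r ^ 2 - w.1 ^ 2 ≤ ‖w.2‖ ^ 2 ∧
      ‖w.2‖ ^ 2 < r ^ 2 - w.1 ^ 2 + ((r + δ) ^ 2 - r ^ 2))} with hT
  have hTm : MeasurableSet T := by
    have m1 : MeasurableSet {w : ℝ × EuclideanSpace ℝ (Fin (k + 2)) | r ^ 2 - w.1 ^ 2 ≤ ‖w.2‖ ^ 2} :=
      measurableSet_le (by fun_prop) (by fun_prop)
    have m2 : MeasurableSet {w : ℝ × EuclideanSpace ℝ (Fin (k + 2)) |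
        ‖w.2‖ ^ 2 < r ^ 2 - w.1 ^ 2 + ((r + δ) ^ 2 - r ^ 2)} :=
      measurableSet_lt (by fun_prop) (by fun_prop)
    exact (measurable_fst measurableSet_Icc).inter (m1.inter m2)
  have hsub : ((ball x (r + δ) \ ball x r) ∩ (ball y (s + δ) \ ball y s)) ⊆
      (fun p => p - x) ⁻¹' (e ⁻¹' T) := by
    rintro p ⟨⟨h1, h2⟩, h3, h4⟩
    simp only [mem_ball, not_lt, dist_eq_norm] at h1 h2 h3 h4
    obtain ⟨i1, i2⟩ := hep (p - x)
    have j1 : ‖p - x‖ ^ 2 < (r + δ) ^ 2 := by gcongr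
    have j2 : r ^ 2 ≤ ‖p - x‖ ^ 2 := pow_le_pow_left₀ (by linarith) h2 _
    have j3 : ‖p - y‖ ^ 2 < (s + δ) ^ 2 := by gcongr
    have j4 : s ^ 2 ≤ ‖p - y‖ ^ 2 := pow_le_pow_left₀ (by linarith) h4 _
    have hin : ‖p - y‖ ^ 2 = ‖p - x‖ ^ 2 - 2 * (d * (e (p - x)).1) + d ^ 2 := by
      rw [i1, real_inner_smul_left, ← mul_assoc d, mul_inv_cancel₀ hd0.ne', one_mul,
        real_inner_comm, hd, ← norm_sub_sq_real]
      congr 2; abel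
    show e (p - x) ∈ T
    refine ⟨⟨?_, ?_⟩, ?_, ?_⟩
    · rw [hα, div_le_iff₀ (by positivity)]; nlinarith
    · have : α + η / d = (r ^ 2 + d ^ 2 - s ^ 2 + η) / (2 * d) := by
        rw [hα]; field_simp; ring
      rw [this, le_div_iff₀ (by positivity)]; nlinarith
    · linarith
    · linarith
  have hvol : volume ((fun p => p - x) ⁻¹' (e ⁻¹' T)) = volume T := by
    rw [(measurePreserving_sub_right volume x).measure_preimage (he.measurable hTm).nullMeasurableSet,
      he.measure_preimage hTm.nullMeasurableSet]
  refine (measure_mono hsub).trans ?_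
  rw [hvol, Measure.volume_eq_prod, Measure.prod_apply hTm]
  calc _ ≤ ∫⁻ w, (Set.Icc α (α + η / d)).indicator (fun _ => ENNReal.ofReal ((k + 1) * (b + 1) ^ k * η) *
        volume (ball (0 : EuclideanSpace ℝ (Fin (k + 2))) 1)) w := by
        apply lintegral_mono
        intro w
        by_cases hw : w ∈ Set.Icc α (α + η / d)
        · rw [Set.indicator_of_mem hw]
          have : Prod.mk w ⁻¹' T ⊆ {q : EuclideanSpace ℝ (Fin (k + 2)) | r ^ 2 - w ^ 2 ≤ ‖q‖ ^ 2 ∧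
            ‖q‖ ^ 2 < r ^ 2 - w ^ 2 + ((r + δ) ^ 2 - r ^ 2)} := fun q hq => hq.2
          refine (measure_mono this).trans ((st_window k (M := b + 1) ?_ ?_ ?_).trans ?_)
          · nlinarith
          · linarith
          · nlinarith [sq_nonneg w]
          · gcongr; linarith
        · have : Prod.mk w ⁻¹' T = ∅ := by
            ext q; simp only [Set.mem_preimage, Set.mem_empty_iff_false, iff_false]
            exact fun hq => hw hq.1
          show volume (Prod.mk w ⁻¹' T) ≤ _
          rw [this]; simp
    _ = _ := by
        rw [lintegral_indicator measurableSet_Icc, setLIntegral_const, Real.volume_Icc,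
          norm_sub_rev, ← hd, add_sub_cancel_left, mul_right_comm, mul_right_comm _ _ (ENNReal.ofReal (δ ^ 2)),
          mul_right_comm _ _ (ENNReal.ofReal (d⁻¹)), ← ENNReal.ofReal_mul (by positivity),
          ← ENNReal.ofReal_mul (by positivity), ← ENNReal.ofReal_mul (by positivity)]
        congr 2
        rw [hη]; field_simp

lemma st_K (k : ℕ) (R : ℝ) :
    ∫⁻ z in ball (0 : EuclideanSpace ℝ (Fin (k + 3))) R, ENNReal.ofReal (‖z‖⁻¹) < ⊤ := by
  have h : IntegrableOn (fun z : EuclideanSpace ℝ (Fin (k + 3)) => ‖z‖⁻¹) (ball 0 R) := by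
    have := (integrableOn_fun_norm_addHaar (volume : Measure (EuclideanSpace ℝ (Fin (k + 3))))
      (f := fun t : ℝ => t⁻¹) (r := R)).2
    apply this
    have h2 : IntegrableOn (fun y : ℝ => y ^ (k + 1)) (Set.Ioo 0 R) :=
      ((continuous_pow (k + 1)).integrableOn_Icc (a := 0) (b := R)).mono_set Set.Ioo_subset_Icc_self
    refine h2.congr_fun ?_ measurableSet_Ioo
    intro y hy
    have : y ≠ 0 := hy.1.ne'
    simp only [finrank_euclideanSpace_fin, smul_eq_mul]
    rw [show k + 3 - 1 = (k + 1) + 1 from rfl, pow_succ _ (k + 1), mul_assoc, mul_inv_cancel₀ this, mul_one]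
  have := h.lintegral_lt_top
  exact this

lemma st_core (k : ℕ) {a b : ℝ} (R : ℝ) (ha : 0 < a) :
    ∃ C : ENNReal, C ≠ ⊤ ∧ ∀ δ : ℝ, 0 < δ → δ ≤ 1 →
      ∀ U E : Set (EuclideanSpace ℝ (Fin (k + 3))), MeasurableSet U → MeasurableSet E →
      E ⊆ ball 0 R → ∀ ρ : EuclideanSpace ℝ (Fin (k + 3)) → ℝ, Measurable ρ →
      (∀ x ∈ E, ρ x ∈ Set.Icc a b) → (∀ x ∈ E, ball x (ρ x + δ) \ ball x (ρ x) ⊆ U) →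
      volume E ≤ C * volume U := by
  set D : ENNReal := ENNReal.ofReal ((k + 1) * (b + 1) ^ k * (2 * b + 1) ^ 2) *
        volume (ball (0 : EuclideanSpace ℝ (Fin (k + 2))) 1) with hD
  set K : ENNReal := ∫⁻ z in ball (0 : EuclideanSpace ℝ (Fin (k + 3))) (2 * R), ENNReal.ofReal (‖z‖⁻¹) with hK
  set c : ENNReal := ENNReal.ofReal (a ^ (k + 2)) * volume (ball (0 : EuclideanSpace ℝ (Fin (k + 3))) 1) with hc
  have hDtop : D ≠ ⊤ := ENNReal.mul_ne_top ENNReal.ofReal_ne_top measure_ball_lt_top.ne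
  have hKtop : K ≠ ⊤ := (st_K k _).ne
  have hctop : c ≠ ⊤ := ENNReal.mul_ne_top ENNReal.ofReal_ne_top measure_ball_lt_top.ne
  have hc0 : c ≠ 0 := by
    refine mul_ne_zero ?_ (measure_ball_pos _ _ one_pos).ne'
    simpa using pow_pos ha (k + 2)
  refine ⟨D * K / c ^ 2, ENNReal.div_ne_top (ENNReal.mul_ne_top hDtop hKtop) (pow_ne_zero _ hc0), ?_⟩
  intro δ hδ hδ1 U E hU hE hER ρ hρ hρab hsh
  set Γ : Set (EuclideanSpace ℝ (Fin (k + 3)) × EuclideanSpace ℝ (Fin (k + 3))) :=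
    {w | w.1 ∈ E ∧ (dist w.2 w.1 < ρ w.1 + δ ∧ ρ w.1 ≤ dist w.2 w.1)} with hΓ
  have hΓm : MeasurableSet Γ := by
    have m1 : MeasurableSet {w : EuclideanSpace ℝ (Fin (k + 3)) × EuclideanSpace ℝ (Fin (k + 3)) |
        dist w.2 w.1 < ρ w.1 + δ} := measurableSet_lt (by fun_prop) (by fun_prop)
    have m2 : MeasurableSet {w : EuclideanSpace ℝ (Fin (k + 3)) × EuclideanSpace ℝ (Fin (k + 3)) |
        ρ w.1 ≤ dist w.2 w.1} := measurableSet_le (by fun_prop) (by fun_prop)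
    exact (measurable_fst hE).inter (m1.inter m2)
  set F : EuclideanSpace ℝ (Fin (k + 3)) × EuclideanSpace ℝ (Fin (k + 3)) → ENNReal :=
    Γ.indicator 1 with hF
  have hFm : Measurable F := measurable_one.indicator hΓm
  have hslice : ∀ x ∈ E, ∀ p, F (x, p) = (ball x (ρ x + δ) \ ball x (ρ x)).indicator 1 p := by
    intro x hx p
    simp [hF, hΓ, Set.indicator, hx]
  have hslice0 : ∀ x ∉ E, ∀ p, F (x, p) = 0 := by
    intro x hx p
    simp [hF, hΓ, Set.indicator, hx]
  have hms : ∀ x, MeasurableSet (ball x (ρ x + δ) \ ball x (ρ x)) := fun x =>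
    measurableSet_ball.diff measurableSet_ball
  set h : EuclideanSpace ℝ (Fin (k + 3)) → ENNReal := fun p => ∫⁻ x, F (x, p) with hh
  have hhm : Measurable h := Measurable.lintegral_prod_left' hFm
  have s1 : c * ENNReal.ofReal δ * volume E ≤ ∫⁻ p, ((U.indicator 1 : EuclideanSpace ℝ (Fin (k + 3)) → ENNReal) * h) p := by
    have : (U.indicator 1 : EuclideanSpace ℝ (Fin (k + 3)) → ENNReal) * h = h := by
      ext p
      by_cases hp : p ∈ U
      · simp [hp]
      · have : h p = 0 := by
          rw [hh]; simp only
          rw [lintegral_eq_zero_iff (by fun_prop)]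
          refine Filter.Eventually.of_forall fun x => ?_
          by_cases hx : x ∈ E
          · show F (x, p) = 0
            rw [hslice x hx]
            exact Set.indicator_of_notMem (fun hq => hp (hsh x hx hq)) _
          · exact hslice0 x hx p
        simp [this]
    rw [this, hh, lintegral_lintegral_swap (by fun_prop), ← setLIntegral_const,
      ← lintegral_indicator hE]
    apply lintegral_mono
    intro x
    by_cases hx : x ∈ E
    · simp only [Set.indicator_of_mem hx, hslice x hx]
      rw [lintegral_indicator_one (hms x)]
      obtain ⟨h1, h2⟩ := hρab x hx
      rw [st_ann _ (by omega) x (by linarith) (by linarith), hc, mul_right_comm,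
        ← ENNReal.ofReal_mul (by positivity)]
      gcongr
      have e1 : (ρ x + δ) ^ (k + 3) - ρ x ^ (k + 3) =
        (ρ x + δ) ^ (k + 2) * δ + ρ x * ((ρ x + δ) ^ (k + 2) - ρ x ^ (k + 2)) := by ring
      have e2 : ρ x ^ (k + 2) ≤ (ρ x + δ) ^ (k + 2) := pow_le_pow_left₀ (by linarith) (by linarith) _
      have e3 : a ^ (k + 2) ≤ (ρ x + δ) ^ (k + 2) := pow_le_pow_left₀ (by linarith) (by linarith) _
      have e4 : 0 ≤ ρ x * ((ρ x + δ) ^ (k + 2) - ρ x ^ (k + 2)) :=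
        mul_nonneg (by linarith) (by linarith)
      rw [e1]
      nlinarith
    · simp [Set.indicator_of_notMem hx]
  have s2 : (∫⁻ p, ((U.indicator 1 : EuclideanSpace ℝ (Fin (k + 3)) → ENNReal) * h) p) ^ 2 ≤ volume U * ∫⁻ p, h p ^ 2 := by
    have := ENNReal.lintegral_mul_le_Lp_mul_Lq volume Real.HolderConjugate.two_two
      (f := U.indicator 1) (g := h) (measurable_one.indicator hU).aemeasurable hhm.aemeasurable
    have hUi : ∫⁻ p, (U.indicator (1 : EuclideanSpace ℝ (Fin (k + 3)) → ENNReal) p) ^ (2 : ℝ) = volume U := by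
      rw [← lintegral_indicator_one hU]
      congr 1; ext p
      by_cases hp : p ∈ U <;> simp [hp]
    rw [hUi] at this
    calc _ ≤ _ := pow_le_pow_left₀ zero_le this 2
      _ = _ := by
        rw [mul_pow, ← ENNReal.rpow_natCast, ← ENNReal.rpow_natCast, ← ENNReal.rpow_mul, ← ENNReal.rpow_mul]
        simp
  have s3 : ∫⁻ p, h p ^ 2 ≤ ENNReal.ofReal (δ ^ 2) * D * K * volume E := by
    have e1 : ∀ p, h p ^ 2 = ∫⁻ x, ∫⁻ y, F (x, p) * F (y, p) := by
      intro p
      rw [sq, hh]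
      simp only
      rw [← lintegral_mul_const _ (by fun_prop)]
      congr 1; ext x
      rw [← lintegral_const_mul _ (by fun_prop)]
    simp_rw [e1]
    rw [lintegral_lintegral_swap (by
      apply Measurable.aemeasurable
      exact Measurable.lintegral_prod_right'
        (f := fun w : (EuclideanSpace ℝ (Fin (k + 3)) × EuclideanSpace ℝ (Fin (k + 3))) × EuclideanSpace ℝ (Fin (k + 3)) =>
          F (w.1.2, w.1.1) * F (w.2, w.1.1)) (by fun_prop))]
    rw [← setLIntegral_const, ← lintegral_indicator hE]
    apply lintegral_mono
    intro x
    simp only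
    rw [lintegral_lintegral_swap (by fun_prop)]
    by_cases hx : x ∈ E
    · rw [Set.indicator_of_mem hx]
      set f : EuclideanSpace ℝ (Fin (k + 3)) → ENNReal :=
        (ball 0 (2 * R)).indicator (fun z => ENNReal.ofReal (‖z‖⁻¹)) with hf
      have hfm : Measurable f := Measurable.indicator (by fun_prop) measurableSet_ball
      calc _ ≤ ∫⁻ y, ENNReal.ofReal (δ ^ 2) * D * f (x - y) := by
            apply lintegral_mono_ae
            have : ∀ᵐ y : EuclideanSpace ℝ (Fin (k + 3)), y ≠ x := by
              simp [ae_iff]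
            filter_upwards [this] with y hy
            by_cases hyE : y ∈ E
            · have hfy : f (x - y) = ENNReal.ofReal (‖x - y‖⁻¹) := by
                rw [hf, Set.indicator_of_mem]
                have h1 := hER hx
                have h2 := hER hyE
                rw [mem_ball_zero_iff] at *
                calc _ ≤ _ := norm_sub_le x y
                  _ < _ := by linarith
              have : ∫⁻ p, F (x, p) * F (y, p) = volume ((ball x (ρ x + δ) \ ball x (ρ x)) ∩ (ball y (ρ y + δ) \ ball y (ρ y))) := by
                rw [← lintegral_indicator_one ((hms x).inter (hms y))]
                congr 1; ext p
                rw [hslice x hx, hslice y hyE, Set.inter_indicator_one]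
                rfl
              rw [this, hfy]
              refine (st_inter k ha (hρab x hx) (hρab y hyE) hδ hδ1 x y hy.symm).trans ?_
              rw [mul_comm (ENNReal.ofReal (δ ^ 2)) D]
            · simp [hslice0 y hyE]
        _ = ENNReal.ofReal (δ ^ 2) * D * ∫⁻ z, f z := by
            rw [lintegral_const_mul _ (by fun_prop), lintegral_sub_left_eq_self f x]
        _ = _ := by
            rw [hf, lintegral_indicator measurableSet_ball]
    · simp [hslice0 x hx]
  have hEtop : volume E ≠ ⊤ := ((measure_mono hER).trans_lt measure_ball_lt_top).ne
  rcases eq_or_ne (volume E) 0 with h0 | h0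
  · rw [h0]; exact zero_le
  have s4 : (ENNReal.ofReal δ ^ 2 * volume E) * (c ^ 2 * volume E) ≤
      (ENNReal.ofReal δ ^ 2 * volume E) * (D * K * volume U) := by
    calc _ = (c * ENNReal.ofReal δ * volume E) ^ 2 := by ring
      _ ≤ _ := pow_le_pow_left₀ zero_le s1 2
      _ ≤ _ := s2
      _ ≤ volume U * (ENNReal.ofReal (δ ^ 2) * D * K * volume E) := by gcongr
      _ = _ := by rw [ENNReal.ofReal_pow hδ.le]; ring
  have hδ0 : ENNReal.ofReal δ ≠ 0 := by simpa using hδ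
  rw [ENNReal.mul_le_mul_iff_right (mul_ne_zero (pow_ne_zero _ hδ0) h0)
    (ENNReal.mul_ne_top (by finiteness) hEtop)] at s4
  rw [ENNReal.div_eq_inv_mul, mul_assoc, ← ENNReal.div_eq_inv_mul,
    ENNReal.le_div_iff_mul_le (Or.inl (pow_ne_zero _ hc0)) (Or.inl (by finiteness)), mul_comm]
  exact s4

lemma st_thick {V : Type*} [NormedAddCommGroup V] [NormedSpace ℝ V] {x p : V} {r ε : ℝ}
    (hr : 0 < r) (hp : 0 < dist p x) (h : |dist p x - r| < ε) :
    p ∈ thickening ε (sphere x r) := by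
  rw [mem_thickening_iff]
  rw [dist_eq_norm] at *
  refine ⟨x + (r / ‖p - x‖) • (p - x), ?_, ?_⟩
  · rw [mem_sphere, dist_eq_norm, add_sub_cancel_left, norm_smul, Real.norm_of_nonneg (by positivity)]
    field_simp
  · have : p - (x + (r / ‖p - x‖) • (p - x)) = (1 - r / ‖p - x‖) • (p - x) := by
      rw [sub_smul, one_smul]; abel
    rw [dist_eq_norm, this, norm_smul, Real.norm_eq_abs]
    have h2 : |1 - r / ‖p - x‖| * ‖p - x‖ = |‖p - x‖ - r| := by
      rw [← abs_of_pos hp, ← abs_mul, abs_of_pos hp]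
      congr 1; field_simp
    rwa [h2]

lemma st_closed {V : Type*} [NormedAddCommGroup V] [NormedSpace ℝ V] {U : Set V} (s t : ℝ) :
    IsClosed {x : V | ∀ p, s < dist p x → dist p x < t → p ∈ U} := by
  have : {x : V | ∀ p, s < dist p x → dist p x < t → p ∈ U} =
      ⋂ p ∈ Uᶜ, {x | s < dist p x ∧ dist p x < t}ᶜ := by
    ext x
    simp only [Set.mem_ofPred_eq, Set.mem_iInter, Set.mem_compl_iff, not_and]
    constructor
    · intro h p hp h1 h2; exact hp (h p h1 h2)
    · intro h p h1 h2; by_contra hp; exact h p hp h1 h2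
  rw [this]
  refine isClosed_biInter fun p _ => ?_
  rw [isClosed_compl_iff]
  have o1 : IsOpen {x : V | s < dist p x} := isOpen_lt (by fun_prop) (by fun_prop)
  have o2 : IsOpen {x : V | dist p x < t} := isOpen_lt (by fun_prop) (by fun_prop)
  exact o1.inter o2

lemma st_bound (k : ℕ) {a b : ℝ} (R : ℝ) (ha : 0 < a) :
    ∃ C : ENNReal, C ≠ ⊤ ∧ ∀ δ : ℝ, 0 < δ → δ ≤ 1 → 2 * δ ≤ a →
      ∀ U : Set (EuclideanSpace ℝ (Fin (k + 3))), MeasurableSet U →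
      volume {x ∈ ball (0 : EuclideanSpace ℝ (Fin (k + 3))) R |
        ∃ r ∈ Set.Icc a b, thickening (2 * δ) (sphere x r) ⊆ U} ≤ C * volume U := by
  classical
  obtain ⟨C, hC, hcore⟩ := st_core k (a := a / 2) (b := b) R (by linarith)
  refine ⟨C, hC, fun δ hδ hδ1 hδa U hU => ?_⟩
  set P : EuclideanSpace ℝ (Fin (k + 3)) → ℕ → Prop := fun x j =>
    (j * δ ∈ Set.Icc (a / 2) b) ∧ ∀ p, j * δ - δ < dist p x → dist p x < j * δ + 2 * δ → p ∈ U with hP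
  have hPm : ∀ j, MeasurableSet {x | P x j} := fun j =>
    (MeasurableSet.const _).inter (st_closed _ _).measurableSet
  set E : Set (EuclideanSpace ℝ (Fin (k + 3))) := ball 0 R ∩ ⋃ j, {x | P x j} with hE
  have hEm : MeasurableSet E := measurableSet_ball.inter (MeasurableSet.iUnion hPm)
  have hex : ∀ x, ∃ j, x ∉ E ∨ P x j := by
    intro x
    by_cases hx : x ∈ E
    · obtain ⟨j, hj⟩ := Set.mem_iUnion.1 hx.2
      exact ⟨j, Or.inr hj⟩
    · exact ⟨0, Or.inl hx⟩
  have hfind := measurable_find hex (fun j => hEm.compl.union (hPm j))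
  have hspec : ∀ x ∈ E, P x (Nat.find (hex x)) := fun x hx =>
    (Nat.find_spec (hex x)).resolve_left (fun h => h hx)
  refine (measure_mono ?_).trans (hcore δ hδ hδ1 U E hU hEm Set.inter_subset_left
    (fun x => (Nat.find (hex x) : ℝ) * δ) ?_ (fun x hx => (hspec x hx).1) ?_)
  · rintro x ⟨hx, r, ⟨hr1, hr2⟩, hr⟩
    refine ⟨hx, Set.mem_iUnion.2 ⟨⌊r / δ⌋₊, ?_⟩⟩
    have f1 : (⌊r / δ⌋₊ : ℝ) * δ ≤ r := by
      rw [← le_div_iff₀ hδ]; exact Nat.floor_le (by apply div_nonneg <;> linarith)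
    have f2 : r < (⌊r / δ⌋₊ : ℝ) * δ + δ := by
      have := Nat.lt_floor_add_one (r / δ)
      rw [div_lt_iff₀ hδ] at this
      linarith
    refine ⟨⟨by linarith, by linarith⟩, fun p h1 h2 => hr (st_thick (by linarith) (by linarith) ?_)⟩
    rw [abs_lt]; constructor <;> linarith
  · exact (measurable_from_nat.comp hfind : Measurable fun x => ((Nat.find (hex x) : ℕ) : ℝ)).mul_const δ
  · rintro x hx p ⟨h1, h2⟩
    simp only [mem_ball, not_lt] at h1 h2
    exact (hspec x hx).2 p (by linarith) (by linarith)

lemma st_null (k : ℕ) {a b : ℝ} (R : ℝ) (ha : 0 < a) (B : Set (EuclideanSpace ℝ (Fin (k + 3))))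
    (hB : volume B = 0) :
    volume {x ∈ ball (0 : EuclideanSpace ℝ (Fin (k + 3))) R |
        ∃ r ∈ Set.Icc a b, sphere x r ⊆ B} = 0 := by
  obtain ⟨C, hC, hb⟩ := st_bound k (a := a) (b := b) R ha
  have key : ∀ ε : ENNReal, ε ≠ 0 → volume {x ∈ ball (0 : EuclideanSpace ℝ (Fin (k + 3))) R |
        ∃ r ∈ Set.Icc a b, sphere x r ⊆ B} ≤ C * ε := by
    intro ε hε
    obtain ⟨U, hBU, hU, hUε⟩ := Set.exists_isOpen_le_add B volume hε
    rw [hB, zero_add] at hUε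
    set δ : ℕ → ℝ := fun i => min (a / 2) 1 / (i + 1) with hδ
    have hm : 0 < min (a / 2) 1 := lt_min (by linarith) one_pos
    have hδ0 : ∀ i, 0 < δ i := fun i => by positivity
    have hδm : ∀ i, δ i ≤ min (a / 2) 1 := fun i =>
      div_le_self hm.le (by linarith [Nat.cast_nonneg (α := ℝ) i])
    have hanti : Antitone δ := by
      intro i j hij
      simp only [hδ]
      gcongr
    set T : ℕ → Set (EuclideanSpace ℝ (Fin (k + 3))) := fun i =>
      {x ∈ ball (0 : EuclideanSpace ℝ (Fin (k + 3))) R |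
        ∃ r ∈ Set.Icc a b, thickening (2 * δ i) (sphere x r) ⊆ U} with hT
    have hTm : Monotone T := by
      rintro i j hij x ⟨hx, r, hr, h⟩
      exact ⟨hx, r, hr, (thickening_mono (by linarith [hanti hij]) _).trans h⟩
    have hsub : {x ∈ ball (0 : EuclideanSpace ℝ (Fin (k + 3))) R |
        ∃ r ∈ Set.Icc a b, sphere x r ⊆ B} ⊆ ⋃ i, T i := by
      rintro x ⟨hx, r, hr, h⟩
      obtain ⟨η, hη, hη2⟩ := (isCompact_sphere x r).exists_thickening_subset_open hU (h.trans hBU)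
      obtain ⟨i, hi⟩ := exists_nat_gt (2 * min (a / 2) 1 / η)
      refine Set.mem_iUnion.2 ⟨i, hx, r, hr, (thickening_mono ?_ _).trans hη2⟩
      rw [div_lt_iff₀ hη] at hi
      simp only [hδ]
      rw [← mul_div_assoc, div_le_iff₀ (by positivity)]
      linarith
    calc _ ≤ volume (⋃ i, T i) := measure_mono hsub
      _ = ⨆ i, volume (T i) := hTm.measure_iUnion
      _ ≤ C * volume U := iSup_le fun i => hb (δ i) (hδ0 i) ((hδm i).trans (min_le_right _ _))
          (by linarith [(hδm i).trans (min_le_left _ _)]) U hU.measurableSet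
      _ ≤ C * ε := by gcongr
  by_contra hne
  have hpos := pos_iff_ne_zero.2 hne
  have h1 := key ⊤
  rcases eq_or_ne C 0 with h0 | h0
  · have := key 1 one_ne_zero
    rw [h0, zero_mul] at this
    exact hne (le_antisymm this zero_le)
  · obtain ⟨ε, hε0, hε⟩ := exists_between (ENNReal.div_pos hne hC)
    have h2 := key ε hε0.ne'
    rw [ENNReal.lt_div_iff_mul_lt (Or.inl h0) (Or.inl hC)] at hε
    rw [mul_comm] at h2
    exact absurd h2 (not_le.2 hε)

/-- **Stein's theorem.** If `n ≥ 3`, `S ⊆ ℝⁿ` has positive Lebesgue outer measure and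
`B` contains a sphere centered at every point of `S`, then `B` has positive Lebesgue
outer measure. -/
theorem stein_spheres (n : ℕ) (hn : 3 ≤ n)
    (S B : Set (EuclideanSpace ℝ (Fin n)))
    (hS : 0 < volume S)
    (hB : ∀ x ∈ S, ∃ r > (0 : ℝ), Metric.sphere x r ⊆ B) :
    0 < volume B := by
  obtain ⟨k, rfl⟩ : ∃ k, n = k + 3 := ⟨n - 3, by omega⟩
  by_contra hB0
  have hB0 : volume B = 0 := by simpa using hB0
  have hnull : volume (⋃ N : ℕ, {x ∈ ball (0 : EuclideanSpace ℝ (Fin (k + 3))) N |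
        ∃ r ∈ Set.Icc (1 / ((N : ℝ) + 1)) N, sphere x r ⊆ B}) = 0 :=
    measure_iUnion_null fun N => st_null k N (by positivity) B hB0
  refine hS.ne' (measure_mono_null ?_ hnull)
  intro x hx
  obtain ⟨r, hr, h⟩ := hB x hx
  obtain ⟨N, hN⟩ := exists_nat_gt (max ‖x‖ (max r (1 / r)))
  rw [max_lt_iff, max_lt_iff] at hN
  refine Set.mem_iUnion.2 ⟨N, by simpa using hN.1, r, ⟨?_, hN.2.1.le⟩, h⟩
  rw [one_div_le (by positivity) hr]
  linarith [hN.2.2]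
end

section
/- Let S ⊆ ℝ² be a set of positive Lebesgue (outer) measure. If B ⊆ ℝ² contains a circle centered at every point of S, i.e. for every x ∈ S there exists r > 0 with Metric.sphere x r ⊆ B, then B has positive Lebesgue (outer) measure. (Bourgain–Marstrand theorem.) -/
open MeasureTheory Metric

set_option linter.unusedVariables false

namespace BM

noncomputable def e1 (t : ℝ) : ℝ := 2 * t / (1 + t ^ 2)
noncomputable def e2 (t : ℝ) : ℝ := (1 - t ^ 2) / (1 + t ^ 2)

lemma e_sq (t : ℝ) : e1 t ^ 2 + e2 t ^ 2 = 1 := by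
  unfold e1 e2
  have : (1 + t ^ 2) ≠ 0 := by positivity
  field_simp
  ring

lemma e1_nonneg {t : ℝ} (h0 : 0 ≤ t) : 0 ≤ e1 t := by unfold e1; positivity
lemma e2_nonneg {t : ℝ} (h0 : 0 ≤ t) (h1 : t ≤ 1) : 0 ≤ e2 t := by
  unfold e2
  apply div_nonneg <;> nlinarith
lemma e1_le {t : ℝ} : e1 t ≤ 1 := by nlinarith [e_sq t, sq_nonneg (e2 t), sq_nonneg (e1 t - 1)]
lemma e2_le {t : ℝ} : e2 t ≤ 1 := by nlinarith [e_sq t, sq_nonneg (e1 t), sq_nonneg (e2 t - 1)]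

lemma e1_sub (t u : ℝ) : e1 t - e1 u = 2 * (t - u) * (1 - t * u) / ((1 + t ^ 2) * (1 + u ^ 2)) := by
  unfold e1
  have : (1 + t ^ 2) ≠ 0 := by positivity
  have : (1 + u ^ 2) ≠ 0 := by positivity
  field_simp
  ring

lemma e2_sub (t u : ℝ) :
    e2 t - e2 u = - (2 * (t - u) * (t + u)) / ((1 + t ^ 2) * (1 + u ^ 2)) := by
  unfold e2
  have : (1 + t ^ 2) ≠ 0 := by positivity
  have : (1 + u ^ 2) ≠ 0 := by positivity
  field_simp
  ring

lemma e1_lip {t u : ℝ} (h0 : 0 ≤ t) (h1 : t ≤ 1) (k0 : 0 ≤ u) (k1 : u ≤ 1) :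
    |e1 t - e1 u| ≤ 2 * |t - u| := by
  rw [e1_sub, abs_div, abs_mul, abs_mul, abs_two]
  have h2 : |1 - t * u| ≤ 1 := by
    rw [abs_le]; constructor <;> nlinarith [mul_nonneg h0 k0]
  have h3 : 1 ≤ |(1 + t ^ 2) * (1 + u ^ 2)| := by
    rw [abs_of_pos (by positivity)]; nlinarith [sq_nonneg t, sq_nonneg u, sq_nonneg (t * u)]
  rw [div_le_iff₀ (by linarith)]
  have := abs_nonneg (t - u)
  calc 2 * |t - u| * |1 - t * u| ≤ 2 * |t - u| * 1 := by gcongr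
    _ ≤ _ := by gcongr

lemma e2_lip {t u : ℝ} (h0 : 0 ≤ t) (h1 : t ≤ 1) (k0 : 0 ≤ u) (k1 : u ≤ 1) :
    |e2 t - e2 u| ≤ 2 * |t - u| := by
  rw [e2_sub, abs_div, abs_neg, abs_mul, abs_mul, abs_two]
  have h2 : |t + u| ≤ |(1 + t ^ 2) * (1 + u ^ 2)| := by
    have hp : 0 < (1 + t ^ 2) * (1 + u ^ 2) := by positivity
    rw [abs_of_pos hp, abs_of_nonneg (add_nonneg h0 k0)]
    nlinarith [sq_nonneg (t-1), sq_nonneg (u-1), sq_nonneg (t * u), sq_nonneg t, sq_nonneg u]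
  rw [div_le_iff₀ (by rw [abs_pos]; positivity)]
  gcongr

/-- the chord lower bound for `e`. -/
lemma e_sep {t u : ℝ} (h0 : 0 ≤ t) (h1 : t ≤ 1) (k0 : 0 ≤ u) (k1 : u ≤ 1) :
    (t - u) ^ 2 ≤ (e1 t - e1 u) ^ 2 + (e2 t - e2 u) ^ 2 := by
  have : (e1 t - e1 u) ^ 2 + (e2 t - e2 u) ^ 2
      = (t - u) ^ 2 * (4 / ((1 + t ^ 2) * (1 + u ^ 2))) := by
    rw [e1_sub, e2_sub]
    have : (1 + t ^ 2) ≠ 0 := by positivity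
    have : (1 + u ^ 2) ≠ 0 := by positivity
    field_simp
    ring
  rw [this]
  have h4 : 1 ≤ 4 / ((1 + t ^ 2) * (1 + u ^ 2)) := by
    rw [le_div_iff₀ (by positivity)]
    have a : 1 + t ^ 2 ≤ 2 := by nlinarith
    have b : 1 + u ^ 2 ≤ 2 := by nlinarith
    nlinarith [mul_le_mul a b (by positivity) (by positivity)]
  nlinarith [sq_nonneg (t - u)]

/-- Difference of radial components. -/
lemma alpha_sub_lower {v1 v2 t u : ℝ} (h0 : 0 ≤ t) (h1 : t ≤ 1) (k0 : 0 ≤ u) (k1 : u ≤ 1)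
    {s : ℝ} 
    (hg : s ^ 2 ≤ (v1 * e2 t - v2 * e1 t) * (v1 * e2 u - v2 * e1 u) ∨
      (0 ≤ (v1 * e2 t - v2 * e1 t) * (v1 * e2 u - v2 * e1 u) ∧
        s ^ 2 ≤ (v1 ^ 2 + v2 ^ 2) * (t - u) ^ 2)) :
    |t - u| * s ≤ 2 * |(v1 * e1 t + v2 * e2 t) - (v1 * e1 u + v2 * e2 u)| := by
  set h := v1 * (1 - t * u) - v2 * (t + u) with hh
  have hp : 0 < (1 + t ^ 2) := by positivity
  have hq : 0 < (1 + u ^ 2) := by positivity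
  have E : (v1 * e1 t + v2 * e2 t) - (v1 * e1 u + v2 * e2 u)
      = 2 * (t - u) * h / ((1 + t ^ 2) * (1 + u ^ 2)) := by
    have := e1_sub t u
    have := e2_sub t u
    have : (v1 * e1 t + v2 * e2 t) - (v1 * e1 u + v2 * e2 u)
      = v1 * (e1 t - e1 u) + v2 * (e2 t - e2 u) := by ring
    rw [this, e1_sub, e2_sub, hh]
    field_simp
    ring
  have gt : (v1 * e2 t - v2 * e1 t) * (1 + t ^ 2) = v1 * (1 - t ^ 2) - 2 * t * v2 := by
    unfold e1 e2; field_simp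
  have gu : (v1 * e2 u - v2 * e1 u) * (1 + u ^ 2) = v1 * (1 - u ^ 2) - 2 * u * v2 := by
    unfold e1 e2; field_simp
  have hsq : h ^ 2 = ((v1 * e2 t - v2 * e1 t) * (v1 * e2 u - v2 * e1 u)) *
      ((1 + t ^ 2) * (1 + u ^ 2)) + (v1 ^ 2 + v2 ^ 2) * (t - u) ^ 2 := by
    have : ((v1 * e2 t - v2 * e1 t) * (v1 * e2 u - v2 * e1 u)) *
      ((1 + t ^ 2) * (1 + u ^ 2)) = ((v1 * e2 t - v2 * e1 t) * (1 + t ^ 2)) *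
        ((v1 * e2 u - v2 * e1 u) * (1 + u ^ 2)) := by ring
    rw [this, gt, gu, hh]; ring
  have hpq : 1 ≤ (1 + t ^ 2) * (1 + u ^ 2) := by
    nlinarith [sq_nonneg t, sq_nonneg u, sq_nonneg (t * u)]
  have hpq' : (1 + t ^ 2) * (1 + u ^ 2) ≤ 4 := by
    have a : 1 + t ^ 2 ≤ 2 := by nlinarith
    have b : 1 + u ^ 2 ≤ 2 := by nlinarith
    nlinarith [mul_le_mul a b (by positivity) (by positivity)]
  have hs : s ^ 2 ≤ h ^ 2 := by
    rw [hsq]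
    set G := (v1 * e2 t - v2 * e1 t) * (v1 * e2 u - v2 * e1 u)
    have h5 : 0 ≤ (v1 ^ 2 + v2 ^ 2) * (t - u) ^ 2 := by positivity
    rcases hg with hg | ⟨hg, hg'⟩
    · nlinarith [sq_nonneg s]
    · nlinarith
  have hs' : s ≤ |h| := by
    rw [sq_le_sq] at hs
    exact (le_abs_self s).trans hs
  rw [E, abs_div, abs_mul, abs_mul, abs_two, abs_of_pos (mul_pos hp hq)]
  rw [← mul_div_assoc, le_div_iff₀ (by positivity)]
  have := abs_nonneg (t - u)
  have hA := abs_nonneg h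
  calc |t - u| * s * ((1 + t ^ 2) * (1 + u ^ 2)) ≤ |t - u| * |h| * ((1 + t ^ 2) * (1 + u ^ 2)) := by
        gcongr
    _ ≤ |t - u| * |h| * 4 := by gcongr
    _ = _ := by ring

set_option maxHeartbeats 1000000 in
lemma three_points {w1 w2 w3 t1 t2 t3 η κ : ℝ} (h0 : 0 ≤ t1) (h3 : t3 ≤ 1) (hκ : 0 < κ)
    (h12 : t1 + κ ≤ t2) (h23 : t2 + κ ≤ t3)
    (b1 : |w1 * e1 t1 + w2 * e2 t1 + w3| ≤ η)
    (b2 : |w1 * e1 t2 + w2 * e2 t2 + w3| ≤ η)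
    (b3 : |w1 * e1 t3 + w2 * e2 t3 + w3| ≤ η) :
    |w1| + |w2| + |w3| ≤ 28 * η / κ ^ 2 := by
  have hη : 0 ≤ η := (abs_nonneg _).trans b1
  have key : ∀ t, 0 ≤ t → t ≤ 1 → |w1 * e1 t + w2 * e2 t + w3| ≤ η →
      |(w3 - w2) * t ^ 2 + 2 * w1 * t + (w3 + w2)| ≤ 2 * η := by
    intro t ht0 ht1 hb
    have : (w3 - w2) * t ^ 2 + 2 * w1 * t + (w3 + w2)
      = (w1 * e1 t + w2 * e2 t + w3) * (1 + t ^ 2) := by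
      unfold e1 e2
      have : (1 + t ^ 2) ≠ 0 := by positivity
      field_simp
      ring
    rw [this, abs_mul, abs_of_pos (show 0 < 1 + t ^ 2 by positivity)]
    have : 1 + t ^ 2 ≤ 2 := by nlinarith
    nlinarith [abs_nonneg (w1 * e1 t + w2 * e2 t + w3)]
  have q1 := key t1 h0 (by linarith) b1
  have q2 := key t2 (by linarith) (by linarith) b2
  have q3 := key t3 (by linarith) h3 b3
  have hκ1 : κ ≤ 1 := by linarith
  set A := w3 - w2 with hA
  set Bq := 2 * w1 with hBq
  set C := w3 + w2 with hC
  -- first divided differences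
  have d12 : |A * (t1 + t2) + Bq| ≤ 4 * η / κ := by
    rw [le_div_iff₀ hκ]
    have : (A * (t1 + t2) + Bq) * (t2 - t1)
      = (A * t2 ^ 2 + Bq * t2 + C) - (A * t1 ^ 2 + Bq * t1 + C) := by ring
    have h := abs_sub (A * t2 ^ 2 + Bq * t2 + C) (A * t1 ^ 2 + Bq * t1 + C)
    rw [← this, abs_mul, abs_of_pos (show 0 < t2 - t1 by linarith)] at h
    nlinarith [abs_nonneg (A * (t1 + t2) + Bq)]
  have d23 : |A * (t2 + t3) + Bq| ≤ 4 * η / κ := by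
    rw [le_div_iff₀ hκ]
    have : (A * (t2 + t3) + Bq) * (t3 - t2)
      = (A * t3 ^ 2 + Bq * t3 + C) - (A * t2 ^ 2 + Bq * t2 + C) := by ring
    have h := abs_sub (A * t3 ^ 2 + Bq * t3 + C) (A * t2 ^ 2 + Bq * t2 + C)
    rw [← this, abs_mul, abs_of_pos (show 0 < t3 - t2 by linarith)] at h
    nlinarith [abs_nonneg (A * (t2 + t3) + Bq)]
  set H := η / κ ^ 2 with hH
  have hHk : 4 * η / κ = 4 * H * κ := by rw [hH]; field_simp
  have hHn : 0 ≤ H := by positivity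
  have hη' : η = H * κ ^ 2 := by rw [hH]; field_simp
  rw [hHk] at d12 d23
  have dA : |A| ≤ 4 * H := by
    have : A * (t3 - t1) = (A * (t2 + t3) + Bq) - (A * (t1 + t2) + Bq) := by ring
    have h := abs_sub (A * (t2 + t3) + Bq) (A * (t1 + t2) + Bq)
    rw [← this, abs_mul, abs_of_pos (show 0 < t3 - t1 by linarith)] at h
    have h5 : |A| * (2 * κ) ≤ 4 * H * (2 * κ) := by
      have : |A| * (2 * κ) ≤ |A| * (t3 - t1) := by gcongr; linarith
      linarith
    exact le_of_mul_le_mul_right h5 (by linarith)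
  have dB : |Bq| ≤ 12 * H := by
    have e : Bq = (A * (t1 + t2) + Bq) - A * (t1 + t2) := by ring
    have h := abs_sub (A * (t1 + t2) + Bq) (A * (t1 + t2))
    rw [← e, abs_mul A, abs_of_nonneg (show 0 ≤ t1 + t2 by linarith)] at h
    have h9 : |A| * (t1 + t2) ≤ 4 * H * 2 := by
      apply mul_le_mul dA _ _ _ <;> linarith
    have h10 : H * κ ≤ H * 1 := by gcongr
    linarith
  have dC : |C| ≤ 18 * H := by
    have e : C = (A * t1 ^ 2 + Bq * t1 + C) - (A * t1 ^ 2 + Bq * t1) := by ring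
    have h := abs_sub (A * t1 ^ 2 + Bq * t1 + C) (A * t1 ^ 2 + Bq * t1)
    have h' := abs_add_le (A * t1 ^ 2) (Bq * t1)
    rw [← e] at h
    rw [abs_mul A, abs_mul Bq, abs_of_nonneg h0, abs_of_nonneg (sq_nonneg t1)] at h'
    have ht1 : t1 ≤ 1 := by linarith
    have h6 : |A| * t1 ^ 2 ≤ |A| := by
      have : t1 ^ 2 ≤ 1 := by nlinarith
      nlinarith [abs_nonneg A]
    have h7 : |Bq| * t1 ≤ |Bq| := by nlinarith [abs_nonneg Bq]
    have h8 : η ≤ H := by rw [hη']; have : κ ^ 2 ≤ 1 := by nlinarith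
                          nlinarith
    linarith
  have r1 : |w1| ≤ 6 * H := by
    have : |Bq| = 2 * |w1| := by rw [hBq, abs_mul, abs_two]
    linarith
  have r2 : |w2| ≤ 11 * H := by
    have h1 := abs_le.1 dA
    have h2 := abs_le.1 dC
    rw [abs_le]
    constructor <;> linarith
  have r3 : |w3| ≤ 11 * H := by
    have h1 := abs_le.1 dA
    have h2 := abs_le.1 dC
    rw [abs_le]
    constructor <;> linarith
  have : 28 * η / κ ^ 2 = 28 * H := by rw [hH]; ring
  linarith

/-- Near-tangency forces near-nullity. -/
lemma near_null {v1 v2 rj ri t d σ δ : ℝ} (hrj : 1 ≤ rj) (hri : 1 ≤ ri)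
    (hd1 : d ≤ 1) (hd0 : 0 < d) (hσ : σ ≤ 1) (hσ0 : 0 < σ) (hv : v1 ^ 2 + v2 ^ 2 ≤ d ^ 2)
    (hγ : |v1 * e2 t - v2 * e1 t| ≤ σ * d) (hδ : δ ≤ σ ^ 2 * d)
    (hF : |rj ^ 2 - ri ^ 2 + (v1 ^ 2 + v2 ^ 2) - 2 * rj * (v1 * e1 t + v2 * e2 t)| ≤ 12 * δ) :
    |v1 * e1 t + v2 * e2 t| ≤ d ∧
    |(v1 * e1 t + v2 * e2 t) + (ri - rj)| ≤ 13 * σ ^ 2 * d ∧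
    |v1 ^ 2 + v2 ^ 2 - (ri - rj) ^ 2| ≤ 196 * σ ^ 2 * d ^ 2 := by
  set α := v1 * e1 t + v2 * e2 t with hα
  set γ := v1 * e2 t - v2 * e1 t with hγ'
  have hag : v1 ^ 2 + v2 ^ 2 = α ^ 2 + γ ^ 2 := by
    have : α ^ 2 + γ ^ 2 = (v1 ^ 2 + v2 ^ 2) * (e1 t ^ 2 + e2 t ^ 2) := by rw [hα, hγ']; ring
    rw [this, e_sq]; ring
  have h1 : |α| ≤ d := by
    apply abs_le_of_sq_le_sq _ hd0.le
    nlinarith [sq_nonneg γ]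
  have hγ2 : γ ^ 2 ≤ σ ^ 2 * d ^ 2 := by
    have := sq_le_sq' (by linarith [(abs_le.1 hγ).1]) (abs_le.1 hγ).2
    linarith [mul_pow σ d 2]
  have hs2 : 0 < σ ^ 2 := by positivity
  have hs2' : σ ^ 2 ≤ 1 := by nlinarith
  have h2 : |α + (ri - rj)| ≤ 13 * σ ^ 2 * d := by
    have e : (α + (ri - rj)) * (rj + ri - α)
        = γ ^ 2 - (rj ^ 2 - ri ^ 2 + (v1 ^ 2 + v2 ^ 2) - 2 * rj * α) := by rw [hag]; ring
    have h5 : 1 ≤ rj + ri - α := by linarith [(abs_le.1 h1).2]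
    have h := abs_sub (γ ^ 2) (rj ^ 2 - ri ^ 2 + (v1 ^ 2 + v2 ^ 2) - 2 * rj * α)
    rw [← e, abs_mul, abs_of_pos (show 0 < rj + ri - α by linarith),
      abs_of_nonneg (sq_nonneg γ)] at h
    have h6 : σ ^ 2 * d ^ 2 ≤ σ ^ 2 * d := by
      have : d ^ 2 ≤ d := by nlinarith
      nlinarith
    nlinarith [abs_nonneg (α + (ri - rj))]
  refine ⟨h1, h2, ?_⟩
  have e : v1 ^ 2 + v2 ^ 2 - (ri - rj) ^ 2 = (2 * α - (α + (ri - rj))) * (α + (ri - rj)) + γ ^ 2 := by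
    rw [hag]; ring
  rw [e]
  have h := abs_add_le ((2 * α - (α + (ri - rj))) * (α + (ri - rj))) (γ ^ 2)
  rw [abs_mul, abs_of_nonneg (sq_nonneg γ)] at h
  have h' := abs_sub (2 * α) (α + (ri - rj))
  rw [abs_mul, abs_two] at h'
  have h7 : |2 * α - (α + (ri - rj))| ≤ 15 * d := by nlinarith
  have h8 : |2 * α - (α + (ri - rj))| * |α + (ri - rj)| ≤ (15 * d) * (13 * σ ^ 2 * d) := by
    gcongr
  nlinarith

set_option maxHeartbeats 1000000 in
/-- The key linear estimate for two circles nearly tangent to a common third circle. -/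
lemma pair_estimate {x1 x2 ri a1 a2 ra b1 b2 rb t u d σ δ Λ β : ℝ}
    (hra : 1 ≤ ra) (hri : 1 ≤ ri) (hrb : 1 ≤ rb) (hΛ : 1 ≤ Λ)
    (ht0 : 0 ≤ t) (ht1 : t ≤ 1) (hu0 : 0 ≤ u) (hu1 : u ≤ 1) (htu : |t - u| ≤ β)
    (hd1 : d ≤ 1) (hd0 : 0 < d) (hσ : σ ≤ 1 / (2 * Λ)) (hσ0 : 0 < σ)
    (hva : (x1 - a1) ^ 2 + (x2 - a2) ^ 2 ≤ d ^ 2)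
    (hvb : (x1 - b1) ^ 2 + (x2 - b2) ^ 2 ≤ d ^ 2)
    (hva' : d ^ 2 ≤ Λ ^ 2 * ((x1 - a1) ^ 2 + (x2 - a2) ^ 2))
    (hvb' : d ^ 2 ≤ Λ ^ 2 * ((x1 - b1) ^ 2 + (x2 - b2) ^ 2))
    (hγa : |(x1 - a1) * e2 t - (x2 - a2) * e1 t| ≤ σ * d)
    (hγb : |(x1 - b1) * e2 u - (x2 - b2) * e1 u| ≤ σ * d) (hδ : δ ≤ σ ^ 2 * d)
    (hFa : |ra ^ 2 - ri ^ 2 + ((x1 - a1) ^ 2 + (x2 - a2) ^ 2)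
      - 2 * ra * ((x1 - a1) * e1 t + (x2 - a2) * e2 t)| ≤ 12 * δ)
    (hFb : |rb ^ 2 - ri ^ 2 + ((x1 - b1) ^ 2 + (x2 - b2) ^ 2)
      - 2 * rb * ((x1 - b1) * e1 u + (x2 - b2) * e2 u)| ≤ 12 * δ)
    (hsgn : 0 ≤ ((x1 - a1) * e1 t + (x2 - a2) * e2 t) * ((x1 - b1) * e1 u + (x2 - b2) * e2 u)) :
    |(b1 - a1) * e1 t + (b2 - a2) * e2 t + (rb - ra)| ≤
      Λ * (392 * σ ^ 2 * d + (|b1 - a1| + |b2 - a2| + |rb - ra|) * (2 * β + 28 * σ)) := by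
  have hσ1 : σ ≤ 1 := hσ.trans (by rw [div_le_one (by positivity)]; linarith)
  obtain ⟨A1, A2, A3⟩ := near_null hra hri hd1 hd0 hσ1 hσ0 hva hγa hδ hFa
  obtain ⟨B1, B2, B3⟩ := near_null hrb hri hd1 hd0 hσ1 hσ0 hvb hγb hδ hFb
  have E1 := e1_lip hu0 hu1 ht0 ht1
  have E2 := e2_lip hu0 hu1 ht0 ht1
  rw [abs_sub_comm u t] at E1 E2
  have e1t := e1_nonneg ht0
  have e1u := e1_nonneg hu0
  have e2t := e2_nonneg ht0 ht1
  have e2u := e2_nonneg hu0 hu1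
  have e1t' := @e1_le t
  have e1u' := @e1_le u
  have e2t' := @e2_le t
  have e2u' := @e2_le u
  have Et := e_sq t
  have Eu := e_sq u
  have r1 : b1 - a1 = (x1 - a1) - (x1 - b1) := by ring
  have r2 : b2 - a2 = (x2 - a2) - (x2 - b2) := by ring
  rw [r1, r2]
  clear r1 r2
  generalize x1 - a1 = p1 at *
  generalize x2 - a2 = p2 at *
  generalize x1 - b1 = q1 at *
  generalize x2 - b2 = q2 at *
  generalize e1 t = c at *
  generalize e2 t = s at *
  generalize e1 u = c' at *
  generalize e2 u = s' at *
  obtain ⟨α, hα⟩ : ∃ p, p = p1 * c + p2 * s := ⟨_, rfl⟩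
  obtain ⟨α', hα'⟩ : ∃ p, p = q1 * c' + q2 * s' := ⟨_, rfl⟩
  obtain ⟨γ, hγ⟩ : ∃ p, p = p1 * s - p2 * c := ⟨_, rfl⟩
  obtain ⟨γ', hγ'⟩ : ∃ p, p = q1 * s' - q2 * c' := ⟨_, rfl⟩
  have P1 : p1 = α * c + γ * s := by rw [hα, hγ]; linear_combination (-p1) * Et
  have P2 : p2 = α * s - γ * c := by rw [hα, hγ]; linear_combination (-p2) * Et
  have Q1 : q1 = α' * c' + γ' * s' := by rw [hα', hγ']; linear_combination (-q1) * Eu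
  have Q2 : q2 = α' * s' - γ' * c' := by rw [hα', hγ']; linear_combination (-q2) * Eu
  have aP : p1 ^ 2 + p2 ^ 2 = α ^ 2 + γ ^ 2 := by
    rw [P1, P2]; linear_combination (α ^ 2 + γ ^ 2) * Et
  have aQ : q1 ^ 2 + q2 ^ 2 = α' ^ 2 + γ' ^ 2 := by
    rw [Q1, Q2]; linear_combination (α' ^ 2 + γ' ^ 2) * Eu
  rw [← hα] at A1 A2 hsgn
  rw [← hα'] at B1 B2 hsgn
  rw [← hγ] at hγa
  rw [← hγ'] at hγb
  have low : ∀ α γ : ℝ, d ^ 2 ≤ Λ ^ 2 * (α ^ 2 + γ ^ 2) → |γ| ≤ σ * d → d / (2 * Λ) ≤ |α| := by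
    intro α γ h hg
    have hg2 : |γ| ≤ d / (2 * Λ) := by
      refine hg.trans ?_
      calc σ * d ≤ 1 / (2 * Λ) * d := by gcongr
        _ = _ := by ring
    by_contra hcon
    push Not at hcon
    have a1 : α ^ 2 < (d / (2 * Λ)) ^ 2 := by
      rw [← sq_abs α]; exact pow_lt_pow_left₀ hcon (abs_nonneg _) two_ne_zero
    have a2 : γ ^ 2 ≤ (d / (2 * Λ)) ^ 2 := by
      rw [← sq_abs γ]; exact pow_le_pow_left₀ (abs_nonneg _) hg2 2
    have a3 : Λ ^ 2 * (d / (2 * Λ)) ^ 2 = d ^ 2 / 4 := by field_simp; ring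
    have hL : 0 < Λ ^ 2 := by positivity
    have a4 := mul_lt_mul_of_pos_left (add_lt_add_of_lt_of_le a1 a2) hL
    have hd2 : 0 < d ^ 2 := by positivity
    linarith only [h, a3, a4, hd2]
  have la := low α γ (by rw [← aP]; exact hva') hγa
  have lb := low α' γ' (by rw [← aQ]; exact hvb') hγb
  have lsum : d / Λ ≤ |α + α'| := by
    have : |α + α'| = |α| + |α'| := (abs_add_eq_add_abs_iff α α').2 (mul_nonneg_iff.1 hsgn)
    rw [this]
    calc d / Λ = d / (2 * Λ) + d / (2 * Λ) := by field_simp; ring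
      _ ≤ _ := add_le_add la lb
  set w1 := p1 - q1 with hw1
  set w2 := p2 - q2 with hw2
  set w3 := rb - ra with hw3
  set ε := α + (ri - ra) with hε
  set ε' := α' + (ri - rb) with hε'
  have iden : (α + α') * (w1 * c + w2 * s + w3) =
      ((p1 ^ 2 + p2 ^ 2 - (ri - ra) ^ 2) - (q1 ^ 2 + q2 ^ 2 - (ri - rb) ^ 2))
      + (w1 * (- (α' * (c' - c)) - γ * s - γ' * s') + w2 * (- (α' * (s' - s)) + γ * c + γ' * c')
        + w3 * (ε + ε')) := by
    have : (p1 ^ 2 + p2 ^ 2 - (ri - ra) ^ 2) - (q1 ^ 2 + q2 ^ 2 - (ri - rb) ^ 2)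
      = w1 * (p1 + q1) + w2 * (p2 + q2) - w3 * ((ri - ra) + (ri - rb)) := by
      rw [hw1, hw2, hw3]; ring
    rw [this, hε, hε']
    linear_combination (-w1) * P1 - w1 * Q1 - w2 * P2 - w2 * Q2
  have hβ : 0 ≤ β := (abs_nonneg _).trans htu
  have sd : 0 ≤ σ * d := by positivity
  have bnd : ∀ c c' s s' g g' : ℝ, |c' - c| ≤ 2 * |t - u| → |s| ≤ 1 → |s'| ≤ 1 → 
      |g| ≤ σ * d → |g'| ≤ σ * d → 
      |-(α' * (c' - c)) + g * s + g' * s'| ≤ d * (2 * β + 28 * σ) := by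
    intro c c' s s' g g' h1 h2 h3 h4 h5
    have i1 : |α' * (c' - c)| ≤ d * (2 * β) := by
      rw [abs_mul]; gcongr; linarith
    have i2 : |g * s| ≤ σ * d * 1 := by rw [abs_mul]; gcongr
    have i3 : |g' * s'| ≤ σ * d * 1 := by rw [abs_mul]; gcongr
    calc |-(α' * (c' - c)) + g * s + g' * s'|
        ≤ |-(α' * (c' - c))| + |g * s| + |g' * s'| := abs_add_three _ _ _
      _ ≤ d * (2 * β) + σ * d * 1 + σ * d * 1 := by
        rw [abs_neg]; exact add_le_add (add_le_add i1 i2) i3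
      _ = d * (2 * β) + 2 * (σ * d) := by ring
      _ ≤ d * (2 * β) + 28 * (σ * d) := by gcongr; norm_num
      _ = d * (2 * β + 28 * σ) := by ring
  have z1 : |(- (α' * (c' - c)) - γ * s - γ' * s')| ≤ d * (2 * β + 28 * σ) := by
    have := bnd c c' s s' (-γ) (-γ') E1 (by rw [abs_of_nonneg e2t]; exact e2t')
      (by rw [abs_of_nonneg e2u]; exact e2u') (by rwa [abs_neg]) (by rwa [abs_neg])
    convert this using 2; ring
  have z2 : |(- (α' * (s' - s)) + γ * c + γ' * c')| ≤ d * (2 * β + 28 * σ) := 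
    bnd s s' c c' γ γ' E2 (by rw [abs_of_nonneg e1t]; exact e1t')
      (by rw [abs_of_nonneg e1u]; exact e1u') hγa hγb
  have z3 : |ε + ε'| ≤ d * (2 * β + 28 * σ) := by
    have h := abs_add_le ε ε'
    have : σ ^ 2 * d ≤ σ * d := by
      have : σ ^ 2 ≤ σ := by nlinarith
      exact mul_le_mul_of_nonneg_right this hd0.le
    calc |ε + ε'| ≤ 13 * σ ^ 2 * d + 13 * σ ^ 2 * d := h.trans (add_le_add A2 B2)
      _ = 26 * (σ ^ 2 * d) := by ring
      _ ≤ 26 * (σ * d) := by gcongr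
      _ ≤ 28 * (σ * d) := by gcongr; norm_num
      _ ≤ d * (2 * β) + 28 * (σ * d) := le_add_of_nonneg_left (by positivity)
      _ = d * (2 * β + 28 * σ) := by ring
  have tot : |(α + α') * (w1 * c + w2 * s + w3)| ≤
      d * (392 * σ ^ 2 * d + (|w1| + |w2| + |w3|) * (2 * β + 28 * σ)) := by
    rw [iden]
    set Z := d * (2 * β + 28 * σ) with hZ
    have y1 : ∀ w z : ℝ, |z| ≤ Z → |w * z| ≤ |w| * Z := by
      intro w z h; rw [abs_mul]; gcongr
    have y2 := y1 w1 _ z1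
    have y3 := y1 w2 _ z2
    have y4 := y1 w3 _ z3
    have y5 := abs_sub (p1 ^ 2 + p2 ^ 2 - (ri - ra) ^ 2) (q1 ^ 2 + q2 ^ 2 - (ri - rb) ^ 2)
    refine (abs_add_le _ _).trans ?_
    refine (add_le_add y5 ((abs_add_le _ _).trans (add_le_add (abs_add_le _ _) le_rfl))).trans ?_
    have : d * (392 * σ ^ 2 * d + (|w1| + |w2| + |w3|) * (2 * β + 28 * σ))
      = 392 * σ ^ 2 * d ^ 2 + (|w1| + |w2| + |w3|) * Z := by rw [hZ]; ring
    rw [this]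
    clear_value Z
    linarith only [A3, B3, y2, y3, y4]
  rw [abs_mul] at tot
  set W := |w1 * c + w2 * s + w3| with hW
  set T := 392 * σ ^ 2 * d + (|w1| + |w2| + |w3|) * (2 * β + 28 * σ) with hT
  have hWn : 0 ≤ W := abs_nonneg _
  have f1 : d / Λ * W ≤ d * T := (mul_le_mul_of_nonneg_right lsum hWn).trans tot
  have f2 : d * W ≤ d * (Λ * T) := by
    have := mul_le_mul_of_nonneg_left f1 (show 0 ≤ Λ by linarith)
    calc d * W = Λ * (d / Λ * W) := by field_simp
      _ ≤ _ := this
      _ = _ := by ring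
  exact le_of_mul_le_mul_left f2 hd0


section
open Finset

lemma card_le_of_fiber {α β : Type*} [DecidableEq β] (s : Finset α) (t : Finset β) (f : α → β)
    (hf : ∀ x ∈ s, f x ∈ t) (q : ℝ) (hq : ∀ b ∈ t, ((s.filter (fun x => f x = b)).card : ℝ) ≤ q) :
    (s.card : ℝ) ≤ t.card * q := by
  rw [Finset.card_eq_sum_card_fiberwise (f := f) (t := t) (fun x hx => hf x hx)]
  push_cast
  calc _ ≤ ∑ b ∈ t, q := Finset.sum_le_sum hq
    _ = _ := by simp

lemma card_le_of_diam (A : Finset ℕ) (L : ℝ) (hL : 0 ≤ L)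
    (h : ∀ n ∈ A, ∀ m ∈ A, |(n : ℝ) - m| ≤ L) : (A.card : ℝ) ≤ L + 1 := by
  rcases A.eq_empty_or_nonempty with rfl | hne
  · simp; linarith
  have hsub : A ⊆ Finset.Icc (A.min' hne) (A.min' hne + ⌊L⌋₊) := by
    intro n hn
    rw [Finset.mem_Icc]
    refine ⟨A.min'_le n hn, ?_⟩
    have h1 := h n hn _ (A.min'_mem hne)
    have h2 := A.min'_le n hn
    have h3 : ((n - A.min' hne : ℕ) : ℝ) ≤ L := by
      rw [Nat.cast_sub h2]; exact (le_abs_self _).trans h1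
    have := Nat.le_floor h3
    omega
  have h4 := Finset.card_le_card hsub
  rw [Nat.card_Icc] at h4
  have h5 : A.card ≤ ⌊L⌋₊ + 1 := by omega
  have h6 := Nat.floor_le hL
  have : (A.card : ℝ) ≤ (⌊L⌋₊ : ℝ) + 1 := by exact_mod_cast h5
  linarith

lemma three_groups (A : Finset ℕ) (k : ℕ) (hk : 5 * k ≤ A.card) :
    ∃ A1 A2 A3 : Finset ℕ, A1 ⊆ A ∧ A2 ⊆ A ∧ A3 ⊆ A ∧ A1.card = k ∧ A2.card = k ∧ A3.card = k ∧
      (∀ x ∈ A1, ∀ y ∈ A2, x + k ≤ y) ∧ (∀ x ∈ A2, ∀ y ∈ A3, x + k ≤ y) := by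
  classical
  set f := A.orderEmbOfFin rfl
  -- strictly monotone enumeration on ℕ
  have hfm : ∀ a b : Fin A.card, a ≤ b → f a + (b.1 - a.1) ≤ f b := by
    intro a b hab
    obtain ⟨a, ha⟩ := a
    obtain ⟨b, hb⟩ := b
    simp only [Fin.mk_le_mk] at hab
    induction b, hab using Nat.le_induction with
    | base => simp
    | succ b hab ih =>
      have h1 := ih (by omega)
      have h2 : f ⟨b, by omega⟩ < f ⟨b + 1, hb⟩ := by
        apply f.strictMono; simp
      simp only at *
      omega
  let g : ℕ → ℕ := fun x => if h : x < A.card then f ⟨x, h⟩ else 0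
  have hg : ∀ a b, a ≤ b → b < A.card → g a + (b - a) ≤ g b := by
    intro a b hab hb
    simp only [g, hb, show a < A.card by omega, dif_pos]
    exact hfm ⟨a, by omega⟩ ⟨b, hb⟩ hab
  have hgA : ∀ a, a < A.card → g a ∈ A := by
    intro a ha
    simp only [g, ha, dif_pos]
    exact A.orderEmbOfFin_mem rfl _
  have hcard : ∀ s, s + k ≤ A.card → ((Finset.Ico s (s + k)).image g).card = k := by
    intro s hs
    rw [Finset.card_image_of_injOn]
    · simp
    · intro a ha b hb hab
      simp only [Finset.coe_Ico, Set.mem_Ico] at ha hb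
      rcases le_total a b with h | h
      · have := hg a b h (by omega); omega
      · have := hg b a h (by omega); omega
  refine ⟨(Finset.Ico 0 (0 + k)).image g, (Finset.Ico (2 * k) (2 * k + k)).image g,
    (Finset.Ico (4 * k) (4 * k + k)).image g, ?_, ?_, ?_, hcard _ (by omega), hcard _ (by omega),
    hcard _ (by omega), ?_, ?_⟩
  · intro x hx
    simp only [Finset.mem_image, Finset.mem_Ico] at hx
    obtain ⟨a, ha, rfl⟩ := hx
    exact hgA _ (by omega)
  · intro x hx
    simp only [Finset.mem_image, Finset.mem_Ico] at hx
    obtain ⟨a, ha, rfl⟩ := hx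
    exact hgA _ (by omega)
  · intro x hx
    simp only [Finset.mem_image, Finset.mem_Ico] at hx
    obtain ⟨a, ha, rfl⟩ := hx
    exact hgA _ (by omega)
  · intro x hx y hy
    simp only [Finset.mem_image, Finset.mem_Ico] at hx hy
    obtain ⟨a, ha, rfl⟩ := hx
    obtain ⟨b, hb, rfl⟩ := hy
    have := hg a b (by omega) (by omega)
    omega
  · intro x hx y hy
    simp only [Finset.mem_image, Finset.mem_Ico] at hx hy
    obtain ⟨a, ha, rfl⟩ := hx
    obtain ⟨b, hb, rfl⟩ := hy
    have := hg a b (by omega) (by omega)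
    omega

lemma geom_half (L : ℕ) : ∑ l ∈ range L, ((1:ℝ)/2) ^ l ≤ 2 := by
  have := Summable.sum_le_tsum (f := fun l : ℕ => ((1:ℝ)/2) ^ l) (range L)
    (fun i _ => by positivity) summable_geometric_two
  rwa [tsum_geometric_two] at this

lemma pigeon {α : Type*} (A : Finset α) (φ : α → ℕ × ℕ × Bool) (T : ℝ) (hT : 0 < T)
    (hA : T ≤ A.card) :
    ∃ c : ℕ × ℕ × Bool, T * (((1:ℝ)/2) ^ c.1 * (1/2) ^ c.2.1) / 8 ≤
      (A.filter (fun a => φ a = c)).card := by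
  classical
  by_contra hcon
  push Not at hcon
  set L := (A.sup (fun a => (φ a).1 + (φ a).2.1)) + 1 with hL
  set t : Finset (ℕ × ℕ × Bool) := range L ×ˢ range L ×ˢ univ with ht
  have hmap : ∀ x ∈ A, φ x ∈ t := by
    intro x hx
    have : (φ x).1 + (φ x).2.1 ≤ A.sup (fun a => (φ a).1 + (φ a).2.1) :=
      Finset.le_sup (f := fun a => (φ a).1 + (φ a).2.1) hx
    simp only [ht, mem_product, mem_range, mem_univ, and_true]
    omega
  have h1 := Finset.card_eq_sum_card_fiberwise (f := φ) (t := t) (s := A) (fun x hx => hmap x hx)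
  have hne : A.Nonempty := by
    rw [← Finset.card_pos]
    have : (0:ℝ) < A.card := lt_of_lt_of_le hT hA
    exact_mod_cast this
  have htne : t.Nonempty := ⟨_, hmap _ hne.choose_spec⟩
  have h2 : (A.card : ℝ) < ∑ c ∈ t, T * (((1:ℝ)/2) ^ c.1 * (1/2) ^ c.2.1) / 8 := by
    rw [h1]; push_cast
    exact Finset.sum_lt_sum_of_nonempty htne (fun c _ => hcon c)
  have h3 : ∑ c ∈ t, T * (((1:ℝ)/2) ^ c.1 * (1/2) ^ c.2.1) / 8
      = T / 8 * ((∑ l ∈ range L, ((1:ℝ)/2) ^ l) * ((∑ l ∈ range L, ((1:ℝ)/2) ^ l) * 2)) := by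
    rw [ht, Finset.sum_product, Finset.sum_mul, Finset.mul_sum]
    refine Finset.sum_congr rfl fun l _ => ?_
    rw [Finset.sum_product, Finset.sum_mul, Finset.mul_sum, Finset.mul_sum]
    refine Finset.sum_congr rfl fun k _ => ?_
    simp
    ring
  have h4 := geom_half L
  have h5 : 0 ≤ ∑ l ∈ range L, ((1:ℝ)/2) ^ l := Finset.sum_nonneg fun i _ => by positivity
  have h6 : ((∑ l ∈ range L, ((1:ℝ)/2) ^ l) * ((∑ l ∈ range L, ((1:ℝ)/2) ^ l) * 2)) ≤ 8 := by
    nlinarith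
  rw [h3] at h2
  nlinarith

section
variable {ι : Type*} [Fintype ι]

noncomputable def D2 (X Y : ι → ℝ) (j i : ι) : ℝ := (X i - X j) ^ 2 + (Y i - Y j) ^ 2
noncomputable def al (X Y : ι → ℝ) (j i : ι) (t : ℝ) : ℝ := (X i - X j) * e1 t + (Y i - Y j) * e2 t
noncomputable def ga (X Y : ι → ℝ) (j i : ι) (t : ℝ) : ℝ := (X i - X j) * e2 t - (Y i - Y j) * e1 t
noncomputable def Fn (X Y r : ι → ℝ) (j i : ι) (t : ℝ) : ℝ :=
  r j ^ 2 - r i ^ 2 + D2 X Y j i - 2 * r j * al X Y j i t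

structure Cl (N : ℕ) (X Y r : ι → ℝ) (Λ d σ : ℝ) (s : Bool) (j : ι) (n : ℕ) (i : ι) : Prop where
  hF : |Fn X Y r j i (n / N)| ≤ 12 * (1 / N)
  hv : D2 X Y j i ≤ d ^ 2
  hv' : d ^ 2 ≤ Λ ^ 2 * D2 X Y j i
  hg : |ga X Y j i (n / N)| ≤ σ * d
  hδ : 1 / (N:ℝ) ≤ σ ^ 2 * d
  hor : σ * d ≤ Λ * |ga X Y j i (n / N)| ∨ σ ^ 2 * d ≤ Λ ^ 2 * (1 / N)
  hs : s = true ↔ 0 ≤ al X Y j i (n / N)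

open Classical in
lemma countA {N : ℕ} (hN : 0 < N) {X Y r : ι → ℝ} {Λ d σ : ℝ} {s : Bool} (hΛ : 1 ≤ Λ)
    (hd : 0 < d) (hd1 : d ≤ 1) (hσ : 0 < σ) (hσ1 : σ ≤ 1) (hr : ∀ i, 1 ≤ r i) (j i : ι) :
    (((range N).filter (fun n => Cl N X Y r Λ d σ s j n i)).card : ℝ) ≤ 50 * Λ ^ 2 / (σ * d) := by
  have hNr : (0:ℝ) < N := by exact_mod_cast hN
  have hsd : 0 < σ * d := by positivity
  have key : ∀ n ∈ range N, ∀ m ∈ range N, Cl N X Y r Λ d σ s j n i → Cl N X Y r Λ d σ s j m i →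
      0 ≤ ga X Y j i (n / N) * ga X Y j i (m / N) → |(n:ℝ) - m| ≤ 24 * Λ ^ 2 / (σ * d) := by
    intro n hn m hm Cn Cm hsg
    have hn' : (n:ℝ) ≤ N := by exact_mod_cast (mem_range.1 hn).le
    have hm' : (m:ℝ) ≤ N := by exact_mod_cast (mem_range.1 hm).le
    have ht0 : (0:ℝ) ≤ n / N := by positivity
    have hu0 : (0:ℝ) ≤ m / N := by positivity
    have ht1 : (n:ℝ) / N ≤ 1 := by rw [div_le_one hNr]; exact hn'
    have hu1 : (m:ℝ) / N ≤ 1 := by rw [div_le_one hNr]; exact hm'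
    have hal : 2 * |al X Y j i (n / N) - al X Y j i (m / N)| ≤ 24 * (1 / N) := by
      have h1 := abs_sub (Fn X Y r j i (n / N)) (Fn X Y r j i (m / N))
      have h2 : Fn X Y r j i (n / N) - Fn X Y r j i (m / N)
        = -(2 * r j) * (al X Y j i (n / N) - al X Y j i (m / N)) := by unfold Fn; ring
      rw [h2, abs_mul, abs_neg, abs_of_pos (by linarith [hr j] : 0 < 2 * r j)] at h1
      have := abs_nonneg (al X Y j i (n / N) - al X Y j i (m / N))
      nlinarith [Cn.hF, Cm.hF, hr j]
    have hnm : (n:ℝ) - m = ((n:ℝ) / N - m / N) * N := by field_simp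
    suffices h : |(n:ℝ) / N - m / N| ≤ 24 * Λ ^ 2 * (1 / N) / (σ * d) by
      rw [hnm, abs_mul, abs_of_pos hNr]
      calc _ ≤ 24 * Λ ^ 2 * (1 / N) / (σ * d) * N := by gcongr
        _ = _ := by field_simp
    have hδ0 : (0:ℝ) < 1 / N := by positivity
    have hδ := Cn.hδ
    have hor : (σ * d ≤ Λ * |ga X Y j i (n / N)| ∧ σ * d ≤ Λ * |ga X Y j i (m / N)|) ∨
      σ ^ 2 * d ≤ Λ ^ 2 * (1 / N) := by
      rcases Cn.hor with h | h
      · rcases Cm.hor with h' | h'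
        · exact Or.inl ⟨h, h'⟩
        · exact Or.inr h'
      · exact Or.inr h
    have hv' := Cn.hv'
    clear Cn Cm hnm
    generalize (n:ℝ) / N = t at *
    generalize (m:ℝ) / N = u at *
    generalize (1:ℝ) / N = δ at *
    have hΛ0 : 0 < Λ := by linarith
    have hΛ2 : Λ ≤ Λ ^ 2 := by nlinarith
    rcases hor with ⟨h1, h2⟩ | h
    · have h3 : |t - u| * (σ * d / Λ) ≤ 24 * δ := by
        refine le_trans ?_ hal
        apply alpha_sub_lower ht0 ht1 hu0 hu1
        left
        have a1 : σ * d / Λ ≤ |ga X Y j i t| := by rw [div_le_iff₀ hΛ0]; linarith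
        have a2 : σ * d / Λ ≤ |ga X Y j i u| := by rw [div_le_iff₀ hΛ0]; linarith
        change _ ≤ ga X Y j i t * ga X Y j i u
        rw [← abs_of_nonneg hsg, abs_mul, sq]
        exact mul_le_mul a1 a2 (by positivity) (abs_nonneg _)
      rw [le_div_iff₀ hsd]
      have h4 : |t - u| * (σ * d) = Λ * (|t - u| * (σ * d / Λ)) := by field_simp
      rw [h4]
      calc _ ≤ Λ * (24 * δ) := by gcongr
        _ = Λ * 24 * δ := by ring
        _ ≤ Λ ^ 2 * 24 * δ := by gcongr
        _ = _ := by ring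
    · have h3 : |t - u| * (d / Λ * |t - u|) ≤ 24 * δ := by
        refine le_trans ?_ hal
        apply alpha_sub_lower ht0 ht1 hu0 hu1
        right
        refine ⟨hsg, ?_⟩
        rw [mul_pow, sq_abs, div_pow]
        apply mul_le_mul_of_nonneg_right _ (sq_nonneg _)
        rw [div_le_iff₀ (by positivity)]
        change _ ≤ D2 X Y j i * _
        linarith
      by_contra hcon
      push Not at hcon
      set B := 24 * Λ ^ 2 * δ / (σ * d) with hB
      have hB0 : 0 < B := by positivity
      have hBe : B * (d / Λ * B) = 24 * δ * (24 * Λ) * (Λ ^ 2 * δ) / (σ ^ 2 * d) := by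
        rw [hB]; field_simp
      have h5 : B * (d / Λ * B) < |t - u| * (d / Λ * |t - u|) := by
        gcongr
      have h6 : 24 * δ ≤ B * (d / Λ * B) := by
        rw [hBe, le_div_iff₀ (by positivity)]
        have : 24 * δ * (σ ^ 2 * d) ≤ 24 * δ * (Λ ^ 2 * δ) := by gcongr
        have : 24 * δ * (Λ ^ 2 * δ) ≤ 24 * δ * (Λ ^ 2 * δ) * (24 * Λ) :=
          le_mul_of_one_le_right (by positivity) (by linarith)
        nlinarith
      linarith
  set A := (range N).filter (fun n => Cl N X Y r Λ d σ s j n i) with hA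
  have hL : 0 ≤ 24 * Λ ^ 2 / (σ * d) := by positivity
  have hp := card_le_of_diam (A.filter (fun n : ℕ => 0 ≤ ga X Y j i (n / N))) _ hL (by
    intro n hn m hm
    simp only [hA, mem_filter] at hn hm
    exact key n hn.1.1 m hm.1.1 hn.1.2 hm.1.2 (mul_nonneg hn.2 hm.2))
  have hq := card_le_of_diam (A.filter (fun n : ℕ => ¬ 0 ≤ ga X Y j i (n / N))) _ hL (by
    intro n hn m hm
    simp only [hA, mem_filter, not_le] at hn hm
    exact key n hn.1.1 m hm.1.1 hn.1.2 hm.1.2 (mul_nonneg_of_nonpos_of_nonpos hn.2.le hm.2.le))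
  have hs := Finset.card_filter_add_card_filter_not (s := A) (fun n : ℕ => 0 ≤ ga X Y j i (n / N))
  have hs' : (A.card : ℝ) = ((A.filter (fun n : ℕ => 0 ≤ ga X Y j i (n / N))).card : ℝ)
    + ((A.filter (fun n : ℕ => ¬ 0 ≤ ga X Y j i (n / N))).card : ℝ) := by exact_mod_cast hs.symm
  rw [hs']
  have h1 : 1 ≤ 1 / (σ * d) := by rw [le_div_iff₀ hsd]; nlinarith
  have h2 : 50 * Λ ^ 2 / (σ * d) = 2 * (24 * Λ ^ 2 / (σ * d)) + 2 * Λ ^ 2 * (1 / (σ * d)) := by ring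
  have h3 : 1 ≤ Λ ^ 2 := by nlinarith
  rw [h2]
  nlinarith
end

end

section
open Finset
variable {ι : Type*} [Fintype ι]

open Classical in
lemma dcount {N : ℕ} (hN : 0 < N) {X Y r : ι → ℝ} {Λ d σ : ℝ} {s : Bool} (hΛ : 1 ≤ Λ)
    (hd : 0 < d) (hd1 : d ≤ 1) (hσ : 0 < σ) (hσ1 : σ ≤ 1) (hr : ∀ i, 1 ≤ r i) (j : ι)
    (A : Finset ℕ) (hA : A ⊆ range N) (q : ℝ)
    (hq : ∀ n ∈ A, q ≤ ((univ.filter (fun i => Cl N X Y r Λ d σ s j n i)).card : ℝ)) :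
    A.card * q ≤ ((univ.filter (fun i => ∃ n ∈ A, Cl N X Y r Λ d σ s j n i)).card : ℝ) *
      (50 * Λ ^ 2 / (σ * d)) := by
  set T := univ.filter (fun i => ∃ n ∈ A, Cl N X Y r Λ d σ s j n i) with hT
  have h1 : (A.card : ℝ) * q ≤ ∑ n ∈ A, ((univ.filter (fun i => Cl N X Y r Λ d σ s j n i)).card : ℝ) := by
    rw [← nsmul_eq_mul]
    exact Finset.card_nsmul_le_sum _ _ _ hq
  have h2 : ∑ n ∈ A, ((univ.filter (fun i => Cl N X Y r Λ d σ s j n i)).card : ℝ)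
      = ∑ i ∈ T, ((A.filter (fun n => Cl N X Y r Λ d σ s j n i)).card : ℝ) := by
    have e : ∀ n ∈ A, univ.filter (fun i => Cl N X Y r Λ d σ s j n i)
        = T.filter (fun i => Cl N X Y r Λ d σ s j n i) := by
      intro n hn
      ext i
      simp only [hT, mem_filter, mem_univ, true_and]
      exact ⟨fun h => ⟨⟨n, hn, h⟩, h⟩, fun h => h.2⟩
    rw [Finset.sum_congr rfl (fun n hn => by rw [e n hn])]
    have := Finset.sum_card_bipartiteAbove_eq_sum_card_bipartiteBelow (s := A) (t := T)
      (fun n i => Cl N X Y r Λ d σ s j n i)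
    simp only [bipartiteAbove, bipartiteBelow] at this
    exact_mod_cast this
  rw [h2] at h1
  refine h1.trans ?_
  rw [← nsmul_eq_mul]
  refine Finset.sum_le_card_nsmul _ _ _ fun i _ => ?_
  refine le_trans ?_ (countA hN (X := X) (Y := Y) (s := s) hΛ hd hd1 hσ hσ1 hr j i)
  exact_mod_cast Finset.card_le_card (Finset.filter_subset_filter _ hA)

open Classical in
lemma regime1 {N : ℕ} (hN : 0 < N) {X Y r : ι → ℝ} {Λ d σ : ℝ} {s : Bool} (hΛ : 1 ≤ Λ)
    (hd : 0 < d) (hd1 : d ≤ 1) (hσ : 0 < σ) (hσ1 : σ ≤ 1) (hr : ∀ i, 1 ≤ r i)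
    (Bd : ι → Finset ℕ) (hBd : ∀ j, Bd j ⊆ range N) (q C : ℝ)
    (hq : ∀ j, ∀ n ∈ Bd j, q ≤ ((univ.filter (fun i => Cl N X Y r Λ d σ s j n i)).card : ℝ))
    (hC : ∀ j, ((univ.filter (fun i => D2 X Y j i ≤ d ^ 2)).card : ℝ) ≤ C) :
    (∑ j, ((Bd j).card : ℝ)) * q ≤ Fintype.card ι * (C * (50 * Λ ^ 2 / (σ * d))) := by
  rw [Finset.sum_mul]
  rw [← Finset.card_univ, ← nsmul_eq_mul]
  refine Finset.sum_le_card_nsmul _ _ _ fun j _ => ?_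
  refine (dcount hN hΛ hd hd1 hσ hσ1 hr j _ (hBd j) q (hq j)).trans ?_
  gcongr
  refine le_trans ?_ (hC j)
  have : univ.filter (fun i => ∃ n ∈ Bd j, Cl N X Y r Λ d σ s j n i) ⊆
      univ.filter (fun i => D2 X Y j i ≤ d ^ 2) := by
    intro i hi
    simp only [mem_filter, mem_univ, true_and] at hi ⊢
    obtain ⟨n, _, h⟩ := hi
    exact h.hv
  exact_mod_cast Finset.card_le_card this

lemma D2_tri {X Y : ι → ℝ} {j i k : ι} {d : ℝ} (h1 : D2 X Y j i ≤ d ^ 2) (h2 : D2 X Y j k ≤ d ^ 2) :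
    D2 X Y i k ≤ (2 * d) ^ 2 := by
  unfold D2 at *
  nlinarith [sq_nonneg ((X i - X j) + (X k - X j)), sq_nonneg ((Y i - Y j) + (Y k - Y j))]

set_option maxHeartbeats 1000000 in
/-- Same label implies close. -/
lemma same_label {N : ℕ} (hN : 0 < N) {X Y r : ι → ℝ} {Λ d σ κ β : ℝ} {s : Bool} (hΛ : 1 ≤ Λ)
    (hd : 0 < d) (hd1 : d ≤ 1) (hσ : 0 < σ) (hr : ∀ i, 1 ≤ r i)
    (hκ : 0 < κ) (hκ1 : κ ≤ 1) (hβ : β = κ ^ 2 / (224 * Λ)) (hσκ : σ ≤ κ ^ 2 / (3136 * Λ))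
    (j j' i1 i2 i3 : ι) (n1 n2 n3 m1 m2 m3 : ℕ)
    (hn3 : n3 < N) (hm1 : m1 < N) (hm2 : m2 < N) (hm3 : m3 < N)
    (h12 : κ * N + n1 ≤ n2) (h23 : κ * N + n2 ≤ n3)
    (c1 : Cl N X Y r Λ d σ s j n1 i1) (c2 : Cl N X Y r Λ d σ s j n2 i2)
    (c3 : Cl N X Y r Λ d σ s j n3 i3)
    (c1' : Cl N X Y r Λ d σ s j' m1 i1) (c2' : Cl N X Y r Λ d σ s j' m2 i2)
    (c3' : Cl N X Y r Λ d σ s j' m3 i3)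
    (b1 : |(n1:ℝ) / N - m1 / N| ≤ β) (b2 : |(n2:ℝ) / N - m2 / N| ≤ β)
    (b3 : |(n3:ℝ) / N - m3 / N| ≤ β) :
    D2 X Y j j' ≤ (56 * 392 * Λ / κ ^ 2 * σ ^ 2 * d) ^ 2 := by
  have hNr : (0:ℝ) < N := by exact_mod_cast hN
  have hΛ0 : 0 < Λ := by linarith
  have hκN : 0 < κ * N := by positivity
  have hn3' : (n3:ℝ) < N := by exact_mod_cast hn3
  have hm1' : (m1:ℝ) < N := by exact_mod_cast hm1
  have hm2' : (m2:ℝ) < N := by exact_mod_cast hm2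
  have hm3' : (m3:ℝ) < N := by exact_mod_cast hm3
  have hd1' : ∀ x : ℝ, x ≤ N → x / N ≤ 1 := fun x hx => by rw [div_le_one hNr]; exact hx
  have hσ' : σ ≤ 1 / (2 * Λ) := by
    refine hσκ.trans ?_
    rw [div_le_div_iff₀ (by positivity) (by positivity)]
    have hk2 : κ ^ 2 ≤ 1 := by nlinarith
    nlinarith [mul_nonneg (sub_nonneg.2 hk2) hΛ0.le]
  have sg : ∀ {x y : ℝ}, (s = true ↔ 0 ≤ x) → (s = true ↔ 0 ≤ y) → 0 ≤ x * y := by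
    intro x y hx hy
    by_cases h : s = true
    · exact mul_nonneg (hx.1 h) (hy.1 h)
    · have h1 : ¬ 0 ≤ x := fun hh => h (hx.2 hh)
      have h2 : ¬ 0 ≤ y := fun hh => h (hy.2 hh)
      exact mul_nonneg_of_nonpos_of_nonpos (not_le.1 h1).le (not_le.1 h2).le
  have P : ∀ (i : ι) (n m : ℕ), (n:ℝ) ≤ N → (m:ℝ) ≤ N → Cl N X Y r Λ d σ s j n i →
      Cl N X Y r Λ d σ s j' m i → |(n:ℝ) / N - m / N| ≤ β →
      |(X j' - X j) * e1 (n / N) + (Y j' - Y j) * e2 (n / N) + (r j' - r j)| ≤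
      Λ * (392 * σ ^ 2 * d + (|X j' - X j| + |Y j' - Y j| + |r j' - r j|) * (2 * β + 28 * σ)) := by
    intro i n m hn hm c c' b
    exact pair_estimate (x1 := X i) (x2 := Y i) (ri := r i) (hr j) (hr i) (hr j') hΛ
      (by positivity) (hd1' _ hn) (by positivity) (hd1' _ hm) b hd1 hd hσ' hσ c.hv c'.hv c.hv' c'.hv'
      c.hg c'.hg c.hδ c.hF c'.hF (sg c.hs c'.hs)
  have P1 := P i1 n1 m1 (by linarith) hm1'.le c1 c1' b1
  have P2 := P i2 n2 m2 (by linarith) hm2'.le c2 c2' b2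
  have P3 := P i3 n3 m3 (by linarith) hm3'.le c3 c3' b3
  have g12 : (n1:ℝ) / N + κ ≤ n2 / N := by
    rw [le_div_iff₀ hNr, add_mul, div_mul_cancel₀ _ hNr.ne']; linarith
  have g23 : (n2:ℝ) / N + κ ≤ n3 / N := by
    rw [le_div_iff₀ hNr, add_mul, div_mul_cancel₀ _ hNr.ne']; linarith
  have TP := three_points (by positivity) (hd1' _ hn3'.le) hκ g12 g23 P1 P2 P3
  set W := |X j' - X j| + |Y j' - Y j| + |r j' - r j| with hW
  have hW0 : 0 ≤ W := by positivity
  have hbs : 2 * β + 28 * σ ≤ κ ^ 2 / (56 * Λ) := by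
    have : κ ^ 2 / (56 * Λ) = 2 * (κ ^ 2 / (224 * Λ)) + 28 * (κ ^ 2 / (3136 * Λ)) := by
      field_simp; norm_num
    rw [this, hβ]; linarith
  have hW1 : W ≤ 28 * (Λ * (392 * σ ^ 2 * d + W * (κ ^ 2 / (56 * Λ)))) / κ ^ 2 := by
    refine TP.trans ?_
    gcongr
  have hW2 : 28 * (Λ * (392 * σ ^ 2 * d + W * (κ ^ 2 / (56 * Λ)))) / κ ^ 2
      = 28 * 392 * Λ / κ ^ 2 * σ ^ 2 * d + W / 2 := by
    field_simp; ring
  have hW3 : W ≤ 56 * 392 * Λ / κ ^ 2 * σ ^ 2 * d := by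
    have : 56 * 392 * Λ / κ ^ 2 * σ ^ 2 * d = 2 * (28 * 392 * Λ / κ ^ 2 * σ ^ 2 * d) := by ring
    rw [this]; linarith
  have h4 : D2 X Y j j' ≤ W ^ 2 := by
    unfold D2
    rw [← sq_abs (X j' - X j), ← sq_abs (Y j' - Y j)]
    have a1 := abs_nonneg (X j' - X j)
    have a2 := abs_nonneg (Y j' - Y j)
    have a3 := abs_nonneg (r j' - r j)
    have : |X j' - X j| + |Y j' - Y j| ≤ W := by rw [hW]; linarith
    nlinarith
  exact h4.trans (pow_le_pow_left₀ hW0 hW3 2)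

open Classical in
lemma triples {X Y : ι → ℝ} (ρ C : ℝ) (hC0 : 0 ≤ C)
    (hC : ∀ j, ((univ.filter (fun i => D2 X Y j i ≤ ρ ^ 2)).card : ℝ) ≤ C) :
    ((univ.filter (fun p : ι × ι × ι => D2 X Y p.1 p.2.1 ≤ ρ ^ 2 ∧ D2 X Y p.1 p.2.2 ≤ ρ ^ 2)).card : ℝ)
      ≤ Fintype.card ι * C ^ 2 := by
  have h : univ.filter (fun p : ι × ι × ι => D2 X Y p.1 p.2.1 ≤ ρ ^ 2 ∧ D2 X Y p.1 p.2.2 ≤ ρ ^ 2) =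
    (univ : Finset ι).biUnion (fun i => {i} ×ˢ ((univ.filter (fun k => D2 X Y i k ≤ ρ ^ 2)) ×ˢ
      (univ.filter (fun k => D2 X Y i k ≤ ρ ^ 2)))) := by
    ext ⟨a, b, c⟩
    simp
  rw [h]
  calc _ ≤ ((∑ i : ι, (({i} ×ˢ ((univ.filter (fun k => D2 X Y i k ≤ ρ ^ 2)) ×ˢ
      (univ.filter (fun k => D2 X Y i k ≤ ρ ^ 2))) : Finset (ι × ι × ι))).card : ℕ) : ℝ) := by
        exact_mod_cast Finset.card_biUnion_le
    _ = ∑ i : ι, ((univ.filter (fun k => D2 X Y i k ≤ ρ ^ 2)).card : ℝ) ^ 2 := by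
        push_cast
        refine Finset.sum_congr rfl fun i _ => ?_
        rw [card_product, card_product]; push_cast; simp; ring
    _ ≤ ∑ i : ι, C ^ 2 := Finset.sum_le_sum fun i _ => by
        have := hC i
        gcongr
    _ = _ := by simp
end

section
open Finset
variable {ι : Type*} [Fintype ι]

lemma floor_close {x y β : ℝ} (hβ : 0 < β) (hx : 0 ≤ x) (hy : 0 ≤ y)
    (h : ⌊x / β⌋₊ = ⌊y / β⌋₊) : |x - y| ≤ β := by
  have a1 := Nat.floor_le (div_nonneg hx hβ.le)
  have a2 := Nat.floor_le (div_nonneg hy hβ.le)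
  have a3 := Nat.lt_floor_add_one (x / β)
  have a4 := Nat.lt_floor_add_one (y / β)
  rw [h] at a1 a3
  have ex : x = x / β * β := by field_simp
  have ey : y = y / β * β := by field_simp
  generalize x / β = u at *
  generalize y / β = v at *
  rw [ex, ey, ← sub_mul, abs_mul, abs_of_pos hβ]
  have : |u - v| ≤ 1 := by rw [abs_le]; constructor <;> linarith
  nlinarith

open Classical in
lemma quad {N : ℕ} (hN : 0 < N) {X Y r : ι → ℝ} {Λ d σ κ β R C1 C2 : ℝ} {s : Bool} (hΛ : 1 ≤ Λ)
    (hd : 0 < d) (hd1 : d ≤ 1) (hσ : 0 < σ) (hr : ∀ i, 1 ≤ r i)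
    (hκ : 0 < κ) (hκ1 : κ ≤ 1) (hβ : β = κ ^ 2 / (224 * Λ)) (hσκ : σ ≤ κ ^ 2 / (3136 * Λ))
    (hR : R = 56 * 392 * Λ / κ ^ 2 * σ ^ 2 * d)
    (hC10 : 0 ≤ C1) (hC20 : 0 ≤ C2)
    (hC1 : ∀ j, ((univ.filter (fun i => D2 X Y j i ≤ (2 * d) ^ 2)).card : ℝ) ≤ C1)
    (hC2 : ∀ j, ((univ.filter (fun i => D2 X Y j i ≤ R ^ 2)).card : ℝ) ≤ C2)
    (J : Finset ι) (A1 A2 A3 : ι → Finset ℕ)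
    (hA1 : ∀ j ∈ J, A1 j ⊆ range N) (hA2 : ∀ j ∈ J, A2 j ⊆ range N) (hA3 : ∀ j ∈ J, A3 j ⊆ range N)
    (h12 : ∀ j ∈ J, ∀ n ∈ A1 j, ∀ m ∈ A2 j, κ * N + n ≤ m)
    (h23 : ∀ j ∈ J, ∀ n ∈ A2 j, ∀ m ∈ A3 j, κ * N + n ≤ m) (T : ℝ) (hT0 : 0 ≤ T)
    (hT1 : ∀ j ∈ J, T ≤ ((univ.filter (fun i => ∃ n ∈ A1 j, Cl N X Y r Λ d σ s j n i)).card : ℝ))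
    (hT2 : ∀ j ∈ J, T ≤ ((univ.filter (fun i => ∃ n ∈ A2 j, Cl N X Y r Λ d σ s j n i)).card : ℝ))
    (hT3 : ∀ j ∈ J, T ≤ ((univ.filter (fun i => ∃ n ∈ A3 j, Cl N X Y r Λ d σ s j n i)).card : ℝ)) :
    J.card * T ^ 3 ≤ Fintype.card ι * C1 ^ 2 * (2 / β) ^ 3 * C2 := by
  have hNr : (0:ℝ) < N := by exact_mod_cast hN
  have hβ0 : 0 < β := by rw [hβ]; positivity
  have hβ1 : β ≤ 1 := by
    rw [hβ, div_le_one (by positivity)]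
    nlinarith
  set T1 : ι → Finset ι := fun j => univ.filter (fun i => ∃ n ∈ A1 j, Cl N X Y r Λ d σ s j n i) with hT1d
  set T2 : ι → Finset ι := fun j => univ.filter (fun i => ∃ n ∈ A2 j, Cl N X Y r Λ d σ s j n i) with hT2d
  set T3 : ι → Finset ι := fun j => univ.filter (fun i => ∃ n ∈ A3 j, Cl N X Y r Λ d σ s j n i) with hT3d
  have ch : ∀ A : ι → Finset ℕ, ∃ f : ι → ι → ℕ, ∀ j i, (∃ n ∈ A j, Cl N X Y r Λ d σ s j n i) →
      f j i ∈ A j ∧ Cl N X Y r Λ d σ s j (f j i) i := by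
    intro A
    refine ⟨fun j i => if h : ∃ n ∈ A j, Cl N X Y r Λ d σ s j n i then h.choose else 0, ?_⟩
    intro j i h
    simp only [h, dif_pos]
    exact h.choose_spec
  obtain ⟨f1, hf1⟩ := ch A1
  obtain ⟨f2, hf2⟩ := ch A2
  obtain ⟨f3, hf3⟩ := ch A3
  set Q : Finset (Σ _ : ι, ι × ι × ι) := J.sigma (fun j => T1 j ×ˢ T2 j ×ˢ T3 j) with hQ
  have hQc : (J.card : ℝ) * T ^ 3 ≤ Q.card := by
    rw [hQ, Finset.card_sigma, ← nsmul_eq_mul]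
    push_cast
    refine Finset.card_nsmul_le_sum _ _ _ fun j hj => ?_
    rw [card_product, card_product]
    push_cast
    have := hT1 j hj
    have := hT2 j hj
    have := hT3 j hj
    calc T ^ 3 = T * (T * T) := by ring
      _ ≤ _ := by gcongr
  refine hQc.trans ?_
  set L : ℕ := ⌊1 / β⌋₊ + 1 with hL
  have hL2 : (L : ℝ) ≤ 2 / β := by
    rw [hL]; push_cast
    have := Nat.floor_le (show 0 ≤ 1 / β by positivity)
    have h1 : 1 ≤ 1 / β := by rw [le_div_iff₀ hβ0]; linarith
    have : 2 / β = 1 / β + 1 / β := by ring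
    linarith
  set lab : ℕ → ℕ := fun n => ⌊((n:ℝ) / N) / β⌋₊ with hlab
  have hlabL : ∀ n, n < N → lab n < L := by
    intro n hn
    rw [hL, hlab]
    simp only
    apply Nat.lt_succ_of_le
    apply Nat.floor_le_floor
    gcongr
    rw [div_le_one hNr]
    exact_mod_cast hn.le
  set P := univ.filter (fun p : ι × ι × ι => D2 X Y p.1 p.2.1 ≤ (2 * d) ^ 2 ∧ D2 X Y p.1 p.2.2 ≤ (2 * d) ^ 2)
    with hP
  set tt : Finset ((ι × ι × ι) × ℕ × ℕ × ℕ) := P ×ˢ range L ×ˢ range L ×ˢ range L with htt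
  let F : (Σ _ : ι, ι × ι × ι) → (ι × ι × ι) × ℕ × ℕ × ℕ := fun p =>
    (p.2, lab (f1 p.1 p.2.1), lab (f2 p.1 p.2.2.1), lab (f3 p.1 p.2.2.2))
  have memQ : ∀ j i1 i2 i3, (⟨j, i1, i2, i3⟩ : Σ _ : ι, ι × ι × ι) ∈ Q →
      j ∈ J ∧ (f1 j i1 ∈ A1 j ∧ Cl N X Y r Λ d σ s j (f1 j i1) i1) ∧
      (f2 j i2 ∈ A2 j ∧ Cl N X Y r Λ d σ s j (f2 j i2) i2) ∧
      (f3 j i3 ∈ A3 j ∧ Cl N X Y r Λ d σ s j (f3 j i3) i3) := by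
    intro j i1 i2 i3 h
    simp only [hQ, mem_sigma, mem_product, hT1d, hT2d, hT3d, mem_filter, mem_univ, true_and] at h
    exact ⟨h.1, hf1 _ _ h.2.1, hf2 _ _ h.2.2.1, hf3 _ _ h.2.2.2⟩
  have hmap : ∀ p ∈ Q, F p ∈ tt := by
    rintro ⟨j, i1, i2, i3⟩ hp
    obtain ⟨hj, ⟨a1, c1⟩, ⟨a2, c2⟩, ⟨a3, c3⟩⟩ := memQ _ _ _ _ hp
    simp only [F, htt, mem_product, mem_range, hP, mem_filter, mem_univ, true_and]
    exact ⟨⟨D2_tri c1.hv c2.hv, D2_tri c1.hv c3.hv⟩, hlabL _ (mem_range.1 (hA1 j hj a1)),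
      hlabL _ (mem_range.1 (hA2 j hj a2)), hlabL _ (mem_range.1 (hA3 j hj a3))⟩
  have hfib : ∀ b ∈ tt, ((Q.filter (fun p => F p = b)).card : ℝ) ≤ C2 := by
    intro b _
    rcases (Q.filter (fun p => F p = b)).eq_empty_or_nonempty with h0 | ⟨⟨j0, i1, i2, i3⟩, hp0⟩
    · rw [h0]; simpa using hC20
    refine le_trans ?_ (hC2 j0)
    rw [mem_filter] at hp0
    obtain ⟨hp0, hF0⟩ := hp0
    obtain ⟨hj, ⟨a1, c1⟩, ⟨a2, c2⟩, ⟨a3, c3⟩⟩ := memQ _ _ _ _ hp0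
    have : (Q.filter (fun p => F p = b)).card ≤ (univ.filter (fun i => D2 X Y j0 i ≤ R ^ 2)).card := by
      apply Finset.card_le_card_of_injOn (fun p => p.1)
      · rintro ⟨j, k1, k2, k3⟩ hp
        rw [Finset.mem_coe, mem_filter] at hp
        obtain ⟨hp, hF⟩ := hp
        rw [← hF0] at hF
        simp only [F, Prod.mk.injEq] at hF
        obtain ⟨⟨rfl, rfl, rfl⟩, l1, l2, l3⟩ := hF
        obtain ⟨hj', ⟨a1', c1'⟩, ⟨a2', c2'⟩, ⟨a3', c3'⟩⟩ := memQ _ _ _ _ hp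
        simp only [coe_filter, mem_univ, true_and, Set.mem_ofPred_eq]
        rw [hR]
        exact same_label hN hΛ hd hd1 hσ hr hκ hκ1 hβ hσκ j0 j _ _ _ _ _ _ _ _ _
          (mem_range.1 (hA3 _ hj a3)) (mem_range.1 (hA1 _ hj' a1')) (mem_range.1 (hA2 _ hj' a2'))
          (mem_range.1 (hA3 _ hj' a3')) (h12 _ hj _ a1 _ a2) (h23 _ hj _ a2 _ a3)
          c1 c2 c3 c1' c2' c3'
          (floor_close hβ0 (by positivity) (by positivity) l1.symm)
          (floor_close hβ0 (by positivity) (by positivity) l2.symm)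
          (floor_close hβ0 (by positivity) (by positivity) l3.symm)
      · rintro ⟨j, k⟩ hp ⟨j', k'⟩ hp' h
        simp only [Finset.mem_coe, mem_filter] at hp hp'
        simp only at h
        subst h
        have e1 := hp.2.trans hp'.2.symm
        simp only [F, Prod.mk.injEq] at e1
        have : k = k' := e1.1
        rw [this]
    exact_mod_cast this
  refine (card_le_of_fiber Q tt F hmap C2 hfib).trans ?_
  gcongr
  rw [htt, card_product, card_product, card_product, card_range]
  push_cast
  have := triples (2 * d) C1 hC10 hC1
  calc (P.card : ℝ) * (L * (L * L)) = P.card * (L:ℝ) ^ 3 := by ring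
    _ ≤ _ := by gcongr
end

section
open Finset
variable {ι : Type*} [Fintype ι]

lemma real1 {a b K lam σ d Λ M N : ℝ} (ha : 0 < a) (ha1 : a ≤ 1) (hb : 0 < b) (hb1 : b ≤ 1)
    (hΛ : 1 ≤ Λ) (hM : 0 < M) (hN : 0 < N) (hK : 0 < K)
    (hlam : lam = a * b / 16) (hσ : σ = b ^ 20) (hd : d = a ^ 20)
    (hreg : (lam / 20) ^ 2 / (3136 * Λ) ≤ σ)
    (h : lam * M * N * (K * lam * N) ≤ M * (9 * (d * N) ^ 2 * (50 * Λ ^ 2 / (σ * d)))) :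
    K ≤ 115200 * Λ ^ 2 * (321126400 * Λ) ^ 9 := by
  have hΛ0 : 0 < Λ := by linarith
  have hσ0 : 0 < σ := by rw [hσ]; positivity
  have hd0 : 0 < d := by rw [hd]; positivity
  have h1 : K * lam ^ 2 * σ ≤ 450 * Λ ^ 2 * d := by
    have e1 : M * (9 * (d * N) ^ 2 * (50 * Λ ^ 2 / (σ * d))) = (M * N ^ 2 / σ) * (450 * Λ ^ 2 * d) := by
      field_simp; norm_num
    have e2 : lam * M * N * (K * lam * N) = (M * N ^ 2 / σ) * (K * lam ^ 2 * σ) := by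
      field_simp
    rw [e1, e2] at h
    exact le_of_mul_le_mul_left h (by positivity)
  have h2 : a ^ 2 ≤ 321126400 * Λ * b ^ 18 := by
    rw [div_le_iff₀ (by positivity), hσ, hlam] at hreg
    have : b ^ 2 * a ^ 2 ≤ b ^ 2 * (321126400 * Λ * b ^ 18) := by nlinarith
    exact le_of_mul_le_mul_left this (by positivity)
  have h3 : a ^ 18 ≤ (321126400 * Λ) ^ 9 * b ^ 22 := by
    calc a ^ 18 = (a ^ 2) ^ 9 := by ring
      _ ≤ (321126400 * Λ * b ^ 18) ^ 9 := by gcongr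
      _ = (321126400 * Λ) ^ 9 * (b ^ 22 * b ^ 140) := by ring
      _ ≤ (321126400 * Λ) ^ 9 * (b ^ 22 * 1) := by
          gcongr; exact pow_le_one₀ hb.le hb1
      _ = _ := by ring
  have h4 : (a ^ 2 * b ^ 22) * K ≤ (a ^ 2 * b ^ 22) * (115200 * Λ ^ 2 * (321126400 * Λ) ^ 9) := by
    calc (a ^ 2 * b ^ 22) * K = 256 * (K * lam ^ 2 * σ) := by rw [hσ, hlam]; ring
      _ ≤ 256 * (450 * Λ ^ 2 * d) := by gcongr
      _ = 115200 * Λ ^ 2 * a ^ 2 * a ^ 18 := by rw [hd]; ring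
      _ ≤ 115200 * Λ ^ 2 * a ^ 2 * ((321126400 * Λ) ^ 9 * b ^ 22) := by gcongr
      _ = _ := by ring
  exact le_of_mul_le_mul_left h4 (by positivity)

noncomputable def CC (Λ : ℝ) : ℝ :=
  2 * 1000 ^ 3 * Λ ^ 6 * (81 * 16 * 8 * 9) * (89600 * Λ) ^ 3 * (8780800 * Λ) ^ 2

lemma real2 {a b K lam σ d Λ M N T β R : ℝ} (ha : 0 < a) (ha1 : a ≤ 1) (hb : 0 < b) (hb1 : b ≤ 1)
    (hΛ : 1 ≤ Λ) (hM : 0 < M) (hN : 0 < N) (hK : 1 ≤ K)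
    (hlam : lam = a * b / 16) (hσ : σ = b ^ 20) (hd : d = a ^ 20)
    (hT : T = (lam * N / 20) * (K * lam * N) / (50 * Λ ^ 2 / (σ * d)))
    (hβ : β = (lam / 20) ^ 2 / (224 * Λ)) (hR : R = 56 * 392 * Λ / (lam / 20) ^ 2 * σ ^ 2 * d)
    (h : lam * M / 2 * T ^ 3 ≤ M * (9 * (2 * d * N) ^ 2) ^ 2 * (2 / β) ^ 3 * (9 * (R * N) ^ 2)) :
    K ≤ CC Λ * 16 ^ 17 := by
  have hΛ0 : 0 < Λ := by linarith
  have hσ0 : 0 < σ := by rw [hσ]; positivity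
  have hd0 : 0 < d := by rw [hd]; positivity
  have hl0 : 0 < lam := by rw [hlam]; positivity
  have hT' : T = K * lam ^ 2 * N ^ 2 * σ * d / (1000 * Λ ^ 2) := by
    rw [hT]; field_simp; norm_num
  have hβ' : β⁻¹ = 89600 * Λ / lam ^ 2 := by
    rw [hβ]; field_simp; norm_num
  have hR' : R = 8780800 * Λ / lam ^ 2 * σ ^ 2 * d := by
    rw [hR]; field_simp; norm_num
  rw [div_eq_mul_inv 2 β, hT', hβ', hR'] at h
  have h1 : K ^ 3 * lam ^ 17 ≤ CC Λ * (σ * d ^ 3) := by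
    have e1 : lam * M / 2 * (K * lam ^ 2 * N ^ 2 * σ * d / (1000 * Λ ^ 2)) ^ 3
      = (M * N ^ 6 * σ ^ 3 * d ^ 3 / (lam ^ 10 * (2 * 1000 ^ 3 * Λ ^ 6))) * (K ^ 3 * lam ^ 17) := by
      field_simp
    have e2 : M * (9 * (2 * d * N) ^ 2) ^ 2 * (2 * (89600 * Λ / lam ^ 2)) ^ 3 *
        (9 * (8780800 * Λ / lam ^ 2 * σ ^ 2 * d * N) ^ 2)
      = (M * N ^ 6 * σ ^ 3 * d ^ 3 / (lam ^ 10 * (2 * 1000 ^ 3 * Λ ^ 6))) * (CC Λ * (σ * d ^ 3)) := by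
      unfold CC
      field_simp
      norm_num
    rw [e1, e2] at h
    exact le_of_mul_le_mul_left h (by positivity)
  have hC : 0 ≤ CC Λ := by unfold CC; positivity
  have h2 : (a ^ 17 * b ^ 17) * K ≤ (a ^ 17 * b ^ 17) * (CC Λ * 16 ^ 17) := by
    calc (a ^ 17 * b ^ 17) * K ≤ (a ^ 17 * b ^ 17) * K ^ 3 := by
          gcongr; exact le_self_pow₀ hK (by norm_num)
      _ = 16 ^ 17 * (K ^ 3 * lam ^ 17) := by rw [hlam]; ring
      _ ≤ 16 ^ 17 * (CC Λ * (σ * d ^ 3)) := by gcongr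
      _ = 16 ^ 17 * CC Λ * (a ^ 17 * b ^ 17) * (a ^ 43 * b ^ 3) := by rw [hσ, hd]; ring
      _ ≤ 16 ^ 17 * CC Λ * (a ^ 17 * b ^ 17) * (1 * 1) := by
          gcongr
          · exact pow_le_one₀ ha.le ha1
          · exact pow_le_one₀ hb.le hb1
      _ = _ := by ring
  exact le_of_mul_le_mul_left h2 (by positivity)

open Classical in
lemma core {N : ℕ} (hN : 0 < N) {X Y r : ι → ℝ} {Λ d σ a b K lam : ℝ} {s : Bool} (hΛ : 1 ≤ Λ)
    (ha : 0 < a) (ha1 : a ≤ 1) (hb : 0 < b) (hb1 : b ≤ 1) (hK : 1 ≤ K)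
    (hlam : lam = a * b / 16) (hσ : σ = b ^ 20) (hd : d = a ^ 20)
    (hM : 0 < Fintype.card ι)
    (hr : ∀ i, 1 ≤ r i)
    (hcount : ∀ R : ℝ, 1 / (N:ℝ) ≤ R → ∀ j,
      ((univ.filter (fun i => D2 X Y j i ≤ R ^ 2)).card : ℝ) ≤ 9 * (R * N) ^ 2)
    (Bd : ι → Finset ℕ) (hBd : ∀ j, Bd j ⊆ range N)
    (hδ : 1 / (N:ℝ) ≤ σ ^ 2 * d)
    (hq : ∀ j, ∀ n ∈ Bd j, K * lam * N ≤ ((univ.filter (fun i => Cl N X Y r Λ d σ s j n i)).card : ℝ))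
    (hsum : lam * Fintype.card ι * N ≤ ∑ j, ((Bd j).card : ℝ)) :
    K ≤ max (115200 * Λ ^ 2 * (321126400 * Λ) ^ 9) (CC Λ * 16 ^ 17) := by
  have hΛ0 : 0 < Λ := by linarith
  have hσ0 : 0 < σ := by rw [hσ]; positivity
  have hd0 : 0 < d := by rw [hd]; positivity
  have hσ1 : σ ≤ 1 := by rw [hσ]; exact pow_le_one₀ hb.le hb1
  have hd1 : d ≤ 1 := by rw [hd]; exact pow_le_one₀ ha.le ha1
  have hl0 : 0 < lam := by rw [hlam]; positivity
  have hl1 : lam ≤ 1 := by rw [hlam]; nlinarith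
  have hNr : (0:ℝ) < N := by exact_mod_cast hN
  have hMr : (0:ℝ) < Fintype.card ι := by exact_mod_cast hM
  have hδd : 1 / (N:ℝ) ≤ d := hδ.trans (by nlinarith [pow_le_one₀ (n := 2) hσ0.le hσ1])
  rcases le_total ((lam / 20) ^ 2 / (3136 * Λ)) σ with hreg | hreg
  · apply le_max_of_le_left
    have h1 := regime1 hN (X := X) (Y := Y) (s := s) hΛ hd0 hd1 hσ0 hσ1 hr Bd hBd _ _ hq (hcount d hδd)
    refine real1 ha ha1 hb hb1 hΛ hMr hNr (by linarith) hlam hσ hd hreg (le_trans ?_ h1)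
    gcongr
  · apply le_max_of_le_right
    set κ := lam / 20 with hκ
    have hκ0 : 0 < κ := by rw [hκ]; positivity
    have hκ1 : κ ≤ 1 := by rw [hκ]; linarith
    have hσl : σ ≤ lam / 10 := by
      refine hreg.trans ?_
      rw [div_le_iff₀ (by positivity), hκ]
      nlinarith
    have hlN : 1 ≤ lam * N / 10 := by
      have : 1 / (N:ℝ) ≤ lam / 10 := by
        refine hδ.trans (le_trans ?_ hσl)
        have : σ ^ 2 * d ≤ σ ^ 2 * 1 := by gcongr
        nlinarith
      rw [div_le_iff₀ hNr] at this
      linarith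
    set k := ⌊lam * N / 10⌋₊ with hk
    have hk1 : (k:ℝ) ≤ lam * N / 10 := Nat.floor_le (by positivity)
    have hk2 : κ * N ≤ k := by
      have h1 := Nat.lt_floor_add_one (lam * N / 10)
      rw [← hk] at h1
      have h2 : 1 ≤ k := by rw [hk]; exact Nat.le_floor (by exact_mod_cast hlN)
      have h3 : (1:ℝ) ≤ k := by exact_mod_cast h2
      rw [hκ]; linarith
    set J := univ.filter (fun j => lam * N / 2 ≤ ((Bd j).card : ℝ)) with hJ
    have hJc : lam * Fintype.card ι / 2 ≤ J.card := by
      have h1 : ∑ j, ((Bd j).card : ℝ) ≤ ∑ j, ((if j ∈ J then (N:ℝ) else 0) + lam * N / 2) := by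
        refine Finset.sum_le_sum fun j _ => ?_
        split_ifs with hj
        · have : (Bd j).card ≤ N := by simpa using Finset.card_le_card (hBd j)
          have : ((Bd j).card : ℝ) ≤ N := by exact_mod_cast this
          have : 0 ≤ lam * N / 2 := by positivity
          linarith
        · simp only [hJ, mem_filter, mem_univ, true_and, not_le] at hj
          linarith
      rw [Finset.sum_add_distrib, ← Finset.sum_filter] at h1
      simp only [Finset.sum_const, nsmul_eq_mul, Finset.card_univ, show univ.filter (fun j => j ∈ J) = J by ext; simp] at h1
      have h2 := hsum.trans h1
      have : (N:ℝ) * (lam * Fintype.card ι / 2) ≤ N * J.card := by linarith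
      exact le_of_mul_le_mul_left this hNr
    have hG : ∀ j, ∃ A1 A2 A3 : Finset ℕ, j ∈ J → A1 ⊆ Bd j ∧ A2 ⊆ Bd j ∧ A3 ⊆ Bd j ∧ A1.card = k ∧ A2.card = k ∧
        A3.card = k ∧ (∀ x ∈ A1, ∀ y ∈ A2, x + k ≤ y) ∧ (∀ x ∈ A2, ∀ y ∈ A3, x + k ≤ y) := by
      intro j
      by_cases hj : j ∈ J
      · have hj' := hj
        simp only [hJ, mem_filter, mem_univ, true_and] at hj'
        have : (5:ℝ) * k ≤ (Bd j).card := by linarith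
        obtain ⟨A1, A2, A3, h⟩ := three_groups (Bd j) k (by exact_mod_cast this)
        exact ⟨A1, A2, A3, fun _ => h⟩
      · exact ⟨∅, ∅, ∅, fun h => absurd h hj⟩
    choose A1 A2 A3 hA using hG
    set T := (lam * N / 20) * (K * lam * N) / (50 * Λ ^ 2 / (σ * d)) with hT
    have hT0 : 0 ≤ T := by positivity
    have hTT : ∀ j, ∀ A : Finset ℕ, A ⊆ Bd j → A.card = k →
        T ≤ ((univ.filter (fun i => ∃ n ∈ A, Cl N X Y r Λ d σ s j n i)).card : ℝ) := by
      intro j A hAB hAk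
      rw [hT, div_le_iff₀ (by positivity)]
      refine le_trans ?_ (dcount hN (X := X) (Y := Y) (s := s) hΛ hd0 hd1 hσ0 hσ1 hr j A (hAB.trans (hBd j))
        (K * lam * N) (fun n hn => hq j n (hAB hn)))
      rw [hAk]
      gcongr
      rw [hκ] at hk2
      linarith
    have hgap : ∀ x y : ℕ, x + k ≤ y → κ * N + x ≤ (y:ℝ) := by
      intro x y h
      have : (x:ℝ) + k ≤ y := by exact_mod_cast h
      linarith
    have hσd0 : 0 < σ ^ 2 * d := by positivity
    have hRge : 1 / (N:ℝ) ≤ 56 * 392 * Λ / κ ^ 2 * σ ^ 2 * d := by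
      refine hδ.trans ?_
      have : 1 ≤ 56 * 392 * Λ / κ ^ 2 := by
        rw [le_div_iff₀ (by positivity)]
        nlinarith
      calc σ ^ 2 * d = 1 * (σ ^ 2 * d) := by ring
        _ ≤ 56 * 392 * Λ / κ ^ 2 * (σ ^ 2 * d) := by gcongr
        _ = _ := by ring
    have hquad := quad hN (X := X) (Y := Y) (r := r) (s := s) hΛ hd0 hd1 hσ0 hr hκ0 hκ1 rfl hreg rfl
      (by positivity) (by positivity) (hcount (2 * d) (by linarith)) (hcount _ hRge) J A1 A2 A3
      (fun j hj => (hA j hj).1.trans (hBd j)) (fun j hj => (hA j hj).2.1.trans (hBd j))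
      (fun j hj => (hA j hj).2.2.1.trans (hBd j))
      (fun j hj n hn m hm => hgap _ _ ((hA j hj).2.2.2.2.2.2.1 n hn m hm))
      (fun j hj n hn m hm => hgap _ _ ((hA j hj).2.2.2.2.2.2.2 n hn m hm)) T hT0
      (fun j hj => hTT j _ (hA j hj).1 (hA j hj).2.2.2.1)
      (fun j hj => hTT j _ (hA j hj).2.1 (hA j hj).2.2.2.2.1)
      (fun j hj => hTT j _ (hA j hj).2.2.1 (hA j hj).2.2.2.2.2.1)
    refine real2 ha ha1 hb hb1 hΛ hMr hNr hK hlam hσ hd hT rfl rfl (le_trans ?_ hquad)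
    gcongr
end

section
open Finset

lemma class_exists {ι : Type*} {N : ℕ} (hN : 0 < N) {X Y r : ι → ℝ} (j i : ι) (n : ℕ)
    (hsep : (1 / (N:ℝ)) ^ 2 ≤ D2 X Y j i) (hdiam : D2 X Y j i ≤ 1)
    (hF : |Fn X Y r j i (n / N)| ≤ 12 * (1 / N)) :
    ∃ c : ℕ × ℕ × Bool, Cl N X Y r (2 ^ 20) (((1/2) ^ c.1) ^ 20) (((1/2) ^ c.2.1) ^ 20) c.2.2 j n i := by
  have hNr : (0:ℝ) < N := by exact_mod_cast hN
  have hδ0 : (0:ℝ) < 1 / N := by positivity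
  have hD0 : 0 < D2 X Y j i := lt_of_lt_of_le (by positivity) hsep
  have hy0 : (0:ℝ) < (1/2) ^ 40 := by positivity
  have hy1 : ((1:ℝ)/2) ^ 40 < 1 := by norm_num
  obtain ⟨l, hl1, hl2⟩ := exists_nat_pow_near_of_lt_one hD0 hdiam hy0 hy1
  set d : ℝ := ((1/2) ^ l) ^ 20 with hd
  have hd0 : 0 < d := by positivity
  have hd2 : d ^ 2 = ((1/2) ^ 40) ^ l := by
    rw [hd, ← pow_mul, ← pow_mul, ← pow_mul]; congr 1; ring
  rw [pow_succ, ← hd2] at hl1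
  rw [← hd2] at hl2
  have hga : ga X Y j i (n / N) ^ 2 ≤ d ^ 2 := by
    refine le_trans ?_ hl2
    have : ga X Y j i (n / N) ^ 2 + al X Y j i (n / N) ^ 2 = D2 X Y j i := by
      have h := e_sq ((n:ℝ) / N)
      unfold ga al D2
      linear_combination ((X i - X j) ^ 2 + (Y i - Y j) ^ 2) * h
    nlinarith [sq_nonneg (al X Y j i (n / N))]
  have hδd : 1 / (N:ℝ) ≤ d := by
    have := hsep.trans hl2
    exact le_of_sq_le_sq this hd0.le
  set x := max (ga X Y j i (n / N) ^ 2) (d * (1 / N)) / d ^ 2 with hx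
  have hx0 : 0 < x := by
    apply div_pos _ (by positivity)
    exact lt_of_lt_of_le (by positivity) (le_max_right _ _)
  have hx1 : x ≤ 1 := by
    rw [hx, div_le_one (by positivity)]
    apply max_le hga
    nlinarith
  obtain ⟨k, hk1, hk2⟩ := exists_nat_pow_near_of_lt_one hx0 hx1 hy0 hy1
  set σ : ℝ := ((1/2) ^ k) ^ 20 with hσ
  have hσ0 : 0 < σ := by positivity
  have hσ2 : σ ^ 2 = ((1/2) ^ 40) ^ k := by
    rw [hσ, ← pow_mul, ← pow_mul, ← pow_mul]; congr 1; ring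
  rw [pow_succ, ← hσ2, hx, lt_div_iff₀ (by positivity)] at hk1
  rw [← hσ2, hx, div_le_iff₀ (by positivity)] at hk2
  refine ⟨(l, k, decide (0 ≤ al X Y j i (n / N))), ?_⟩
  refine ⟨hF, hl2, ?_, ?_, ?_, ?_, by simp⟩
  · change d ^ 2 ≤ _
    have e : ((2:ℝ) ^ 20) ^ 2 = 1 / (1/2) ^ 40 := by norm_num
    rw [e, one_div_mul_eq_div, le_div_iff₀ hy0]
    exact hl1.le
  · change _ ≤ σ * d
    apply abs_le_of_sq_le_sq _ (by positivity)
    rw [mul_pow]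
    exact (le_max_left _ _).trans hk2
  · change _ ≤ σ ^ 2 * d
    have := (le_max_right _ _).trans hk2
    have h2 : d * (1 / (N:ℝ)) ≤ d * (σ ^ 2 * d) := by linarith
    exact le_of_mul_le_mul_left h2 hd0
  · change σ * d ≤ _ ∨ σ ^ 2 * d ≤ _
    rcases lt_max_iff.1 hk1 with h | h
    · left
      apply le_of_sq_le_sq _ (by positivity)
      rw [mul_pow, mul_pow, sq_abs]
      have e : ((2:ℝ) ^ 20) ^ 2 = 1 / (1/2) ^ 40 := by norm_num
      rw [e, one_div_mul_eq_div, le_div_iff₀ hy0]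
      linarith
    · right
      have e : ((2:ℝ) ^ 20) ^ 2 = 1 / (1/2) ^ 40 := by norm_num
      rw [e, one_div_mul_eq_div, le_div_iff₀ hy0]
      have h2 : d * (σ ^ 2 * d * (1/2) ^ 40) ≤ d * (1 / (N:ℝ)) := by linarith
      exact le_of_mul_le_mul_left h2 hd0

set_option maxHeartbeats 1000000 in
open Classical in
theorem comb : ∃ K : ℝ, 0 < K ∧ ∀ (ι : Type) [Fintype ι] (N : ℕ) (hN : 0 < N) (X Y r : ι → ℝ)
    (hr : ∀ i, 1 ≤ r i) (hsep : ∀ j i, j ≠ i → (1 / (N:ℝ)) ^ 2 ≤ D2 X Y j i)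
    (hdiam : ∀ j i, D2 X Y j i ≤ 1)
    (hcount : ∀ R : ℝ, 1 / (N:ℝ) ≤ R → ∀ j,
      ((univ.filter (fun i => D2 X Y j i ≤ R ^ 2)).card : ℝ) ≤ 9 * (R * N) ^ 2),
    ((((univ : Finset ι) ×ˢ range N).filter (fun p => K * N ≤
      ((univ.filter (fun i => |Fn X Y r p.1 i (p.2 / N)| ≤ 12 * (1 / N))).card : ℝ))).card : ℝ)
      ≤ Fintype.card ι * N / 2 := by
  set K0 := max (115200 * ((2:ℝ) ^ 20) ^ 2 * (321126400 * (2:ℝ) ^ 20) ^ 9) (CC (2 ^ 20) * 16 ^ 17) with hK0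
  have hK00 : 0 ≤ K0 := le_max_of_le_left (by positivity)
  refine ⟨K0 + 2, by linarith, ?_⟩
  intro ι _ N hN X Y r hr hsep hdiam hcount
  by_contra hcon
  push Not at hcon
  set K := K0 + 2 with hK
  have hNr : (0:ℝ) < N := by exact_mod_cast hN
  have hN1 : (1:ℝ) ≤ N := by exact_mod_cast hN
  set BB := ((univ : Finset ι) ×ˢ range N).filter (fun p => K * N ≤
      ((univ.filter (fun i => |Fn X Y r p.1 i (p.2 / N)| ≤ 12 * (1 / N))).card : ℝ)) with hBB
  have hM : 0 < Fintype.card ι := by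
    rcases Nat.eq_zero_or_pos (Fintype.card ι) with h | h
    · have : IsEmpty ι := Fintype.card_eq_zero_iff.1 h
      have h0 : BB = ∅ := by
        apply Finset.eq_empty_of_forall_notMem
        rintro ⟨j, _⟩ _
        exact this.elim j
      rw [h0, h] at hcon
      simp at hcon
    · exact h
  have hMr : (0:ℝ) < Fintype.card ι := by exact_mod_cast hM
  have hclass : ∀ (j : ι) (n : ℕ) (i : ι), ∃ c : ℕ × ℕ × Bool, j ≠ i → |Fn X Y r j i (n / N)| ≤ 12 * (1 / N) →
      Cl N X Y r (2 ^ 20) (((1/2) ^ c.1) ^ 20) (((1/2) ^ c.2.1) ^ 20) c.2.2 j n i := by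
    intro j n i
    by_cases h : j ≠ i ∧ |Fn X Y r j i (n / N)| ≤ 12 * (1 / N)
    · obtain ⟨c, hc⟩ := class_exists hN j i n (hsep j i h.1) (hdiam j i) h.2
      exact ⟨c, fun _ _ => hc⟩
    · exact ⟨(0, 0, true), fun h1 h2 => absurd ⟨h1, h2⟩ h⟩
  choose φ hφ using hclass
  have hstep : ∀ p : ι × ℕ, ∃ c : ℕ × ℕ × Bool, p ∈ BB →
      K * (((1:ℝ)/2) ^ c.1 * (1/2) ^ c.2.1 / 16) * N ≤ ((univ.filter (fun i =>
        Cl N X Y r (2 ^ 20) (((1/2) ^ c.1) ^ 20) (((1/2) ^ c.2.1) ^ 20) c.2.2 p.1 p.2 i)).card : ℝ) := by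
    rintro ⟨j, n⟩
    by_cases hp : (j, n) ∈ BB
    · have hp' := hp
      simp only [hBB, mem_filter] at hp'
      set I := univ.filter (fun i => |Fn X Y r j i (n / N)| ≤ 12 * (1 / N)) with hI
      have h1 : K * N / 2 ≤ ((I.erase j).card : ℝ) := by
        have h2 : I.card ≤ (I.erase j).card + 1 := by
          have := Finset.pred_card_le_card_erase (s := I) (a := j)
          omega
        have h3 : (I.card : ℝ) ≤ (I.erase j).card + 1 := by exact_mod_cast h2
        have h4 := hp'.2
        have : 2 ≤ K * N := by nlinarith
        linarith
      obtain ⟨c, hc⟩ := pigeon (I.erase j) (φ j n) (K * N / 2) (by positivity) h1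
      refine ⟨c, fun _ => ?_⟩
      refine le_trans (le_of_eq ?_) (hc.trans ?_)
      · ring
      · have : (I.erase j).filter (fun a => φ j n a = c) ⊆ univ.filter (fun i =>
            Cl N X Y r (2 ^ 20) (((1/2) ^ c.1) ^ 20) (((1/2) ^ c.2.1) ^ 20) c.2.2 j n i) := by
          intro i hi
          simp only [mem_filter, mem_erase, hI, mem_univ, true_and] at hi ⊢
          rw [← hi.2]
          exact hφ j n i hi.1.1.symm hi.1.2
        exact_mod_cast Finset.card_le_card this
    · exact ⟨(0, 0, true), fun h => absurd h hp⟩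
  choose ψ hψ using hstep
  obtain ⟨c, hc⟩ := pigeon BB ψ (Fintype.card ι * N / 2) (by positivity) hcon.le
  set a : ℝ := (1/2) ^ c.1 with ha
  set b : ℝ := (1/2) ^ c.2.1 with hb
  have ha0 : 0 < a := by positivity
  have hb0 : 0 < b := by positivity
  have ha1 : a ≤ 1 := pow_le_one₀ (by norm_num) (by norm_num)
  have hb1 : b ≤ 1 := pow_le_one₀ (by norm_num) (by norm_num)
  let Bd : ι → Finset ℕ := fun j => (range N).filter (fun n => (j, n) ∈ BB ∧ ψ (j, n) = c)
  have hq : ∀ j, ∀ n ∈ Bd j, K * (a * b / 16) * N ≤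
      ((univ.filter (fun i => Cl N X Y r (2 ^ 20) (a ^ 20) (b ^ 20) c.2.2 j n i)).card : ℝ) := by
    intro j n hn
    simp only [Bd, mem_filter] at hn
    have := hψ (j, n) hn.2.1
    rw [hn.2.2] at this
    exact this
  have hsum : a * b / 16 * Fintype.card ι * N ≤ ∑ j, ((Bd j).card : ℝ) := by
    refine le_trans (le_of_eq (by ring)) (hc.trans ?_)
    have h1 : BB.filter (fun p => ψ p = c) ⊆ univ.biUnion (fun j => (Bd j).image (fun n => (j, n))) := by
      rintro ⟨j, n⟩ hp
      rw [mem_filter] at hp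
      have hp1 := hp.1
      simp only [hBB, mem_filter, mem_product] at hp1
      simp only [mem_biUnion, mem_univ, true_and, mem_image]
      exact ⟨j, n, mem_filter.2 ⟨hp1.1.2, hp⟩, rfl⟩
    have h2 : (BB.filter (fun p => ψ p = c)).card ≤ ∑ j, (Bd j).card :=
      (Finset.card_le_card h1).trans (Finset.card_biUnion_le.trans
        (Finset.sum_le_sum fun j _ => Finset.card_image_le))
    exact_mod_cast h2
  -- extract `hδ`
  have hδ : 1 / (N:ℝ) ≤ (b ^ 20) ^ 2 * a ^ 20 := by
    have h1 : 0 < ∑ j, ((Bd j).card : ℝ) := lt_of_lt_of_le (by positivity) hsum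
    obtain ⟨j, _, hj⟩ := Finset.exists_ne_zero_of_sum_ne_zero h1.ne'
    have : (Bd j).Nonempty := by
      rw [← Finset.card_pos]; exact Nat.pos_of_ne_zero (by exact_mod_cast hj)
    obtain ⟨n, hn⟩ := this
    have h2 := lt_of_lt_of_le (by positivity) (hq j n hn)
    have h3 : 0 < (univ.filter (fun i => Cl N X Y r (2 ^ 20) (a ^ 20) (b ^ 20) c.2.2 j n i)).card := by
      exact_mod_cast h2
    obtain ⟨i, hi⟩ := Finset.card_pos.1 h3
    exact (mem_filter.1 hi).2.hδ
  have := core hN (X := X) (Y := Y) (r := r) (Λ := 2 ^ 20) (s := c.2.2) (by norm_num) ha0 ha1 hb0 hb1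
    (by linarith : (1:ℝ) ≤ K) rfl rfl rfl hM hr hcount Bd (fun j => Finset.filter_subset _ _) hδ hq hsum
  rw [← hK0] at this
  linarith
end

section
open scoped ENNReal

abbrev E2 := EuclideanSpace ℝ (Fin 2)

lemma dist_sq (x y : E2) : dist x y ^ 2 = (x 0 - y 0) ^ 2 + (x 1 - y 1) ^ 2 := by
  rw [EuclideanSpace.dist_eq, Real.sq_sqrt (by positivity), Fin.sum_univ_two, Real.dist_eq, Real.dist_eq,
    sq_abs, sq_abs]

lemma vol_ball (x : E2) {r : ℝ} (hr : 0 ≤ r) :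
    volume (ball x r) = ENNReal.ofReal (r ^ 2) * volume (ball (0 : E2) 1) := by
  rw [Measure.addHaar_ball _ _ hr]
  simp

lemma vol_ball_one_pos : 0 < volume (ball (0 : E2) 1) := measure_ball_pos _ _ one_pos
lemma vol_ball_one_ne : volume (ball (0 : E2) 1) ≠ ∞ := measure_ball_lt_top.ne

lemma packing (G : Finset E2) (δ R : ℝ) (hδ : 0 < δ) (hR : δ ≤ R)
    (hsep : ∀ x ∈ G, ∀ y ∈ G, x ≠ y → δ ≤ dist x y) (x0 : E2) (hG : ∀ x ∈ G, dist x x0 ≤ R) :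
    (G.card : ℝ) ≤ 9 * (R / δ) ^ 2 := by
  have hdisj : (G : Set E2).PairwiseDisjoint (fun x => ball x (δ / 2)) := by
    intro x hx y hy hxy
    apply ball_disjoint_ball
    have := hsep x hx y hy hxy
    linarith
  have h1 : volume (⋃ x ∈ G, ball x (δ / 2)) = ∑ x ∈ G, volume (ball x (δ / 2)) :=
    measure_biUnion_finset hdisj (fun x _ => measurableSet_ball)
  have h2 : (⋃ x ∈ G, ball x (δ / 2)) ⊆ ball x0 (R + δ / 2) := by
    intro y hy
    simp only [Set.mem_iUnion, mem_ball] at hy ⊢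
    obtain ⟨x, hx, hyx⟩ := hy
    have := dist_triangle y x x0
    linarith [hG x hx]
  have h3 := measure_mono (μ := volume) h2
  rw [h1, vol_ball x0 (by linarith)] at h3
  simp only [vol_ball _ (by linarith : 0 ≤ δ / 2), Finset.sum_const, nsmul_eq_mul] at h3
  rw [← mul_assoc, ENNReal.mul_le_mul_iff_left vol_ball_one_pos.ne' vol_ball_one_ne] at h3
  rw [← ENNReal.ofReal_natCast, ← ENNReal.ofReal_mul (by positivity),
    ENNReal.ofReal_le_ofReal_iff (by positivity)] at h3
  rw [div_pow, ← mul_div_assoc, le_div_iff₀ (by positivity)]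
  nlinarith

noncomputable def pp (x : E2) (ρ t : ℝ) : E2 := x + ρ • !₂[e1 t, e2 t]

lemma pp0 (x : E2) (ρ t : ℝ) : pp x ρ t 0 = x 0 + ρ * e1 t := by simp [pp]
lemma pp1 (x : E2) (ρ t : ℝ) : pp x ρ t 1 = x 1 + ρ * e2 t := by simp [pp]

lemma pp_dist (x : E2) {ρ : ℝ} (hρ : 0 ≤ ρ) (t : ℝ) : dist (pp x ρ t) x = ρ := by
  have h := dist_sq (pp x ρ t) x
  rw [pp0, pp1] at h
  have h2 : dist (pp x ρ t) x ^ 2 = ρ ^ 2 := by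
    rw [h]; linear_combination ρ ^ 2 * e_sq t
  exact (pow_left_inj₀ dist_nonneg hρ two_ne_zero).1 h2

lemma pp_sep (x : E2) {ρ t u : ℝ} (hρ : 1 ≤ ρ) (h0 : 0 ≤ t) (h1 : t ≤ 1) (k0 : 0 ≤ u) (k1 : u ≤ 1) :
    |t - u| ≤ dist (pp x ρ t) (pp x ρ u) := by
  have h := dist_sq (pp x ρ t) (pp x ρ u)
  rw [pp0, pp1, pp0, pp1] at h
  apply abs_le_of_sq_le_sq _ dist_nonneg
  rw [h]
  have h3 := e_sep h0 h1 k0 k1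
  have : (x 0 + ρ * e1 t - (x 0 + ρ * e1 u)) ^ 2 + (x 1 + ρ * e2 t - (x 1 + ρ * e2 u)) ^ 2
    = ρ ^ 2 * ((e1 t - e1 u) ^ 2 + (e2 t - e2 u) ^ 2) := by ring
  rw [this]
  have : 1 ≤ ρ ^ 2 := by nlinarith
  nlinarith [sq_nonneg (t - u)]

lemma Fn_small {ι : Type*} (c : ι → E2) (r : ι → ℝ) (hr : ∀ i, 1 ≤ r i) (hr2 : ∀ i, r i ≤ 2) {δ : ℝ} (hδ0 : 0 < δ)
    (hδ : δ ≤ 1) (j i : ι) (t u : ℝ) (y : E2) (hj : y ∈ ball (pp (c j) (r j) t) δ)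
    (hi : y ∈ ball (pp (c i) (r i) u) δ) :
    |Fn (fun i => c i 0) (fun i => c i 1) r j i t| ≤ 12 * δ := by
  have e : Fn (fun i => c i 0) (fun i => c i 1) r j i t = dist (pp (c j) (r j) t) (c i) ^ 2 - r i ^ 2 := by
    rw [dist_sq, pp0, pp1]
    unfold Fn D2 al
    linear_combination - r j ^ 2 * e_sq t
  rw [mem_ball] at hj hi
  have h1 := pp_dist (c i) (by linarith [hr i] : 0 ≤ r i) u
  have h2 := dist_triangle (pp (c j) (r j) t) (pp (c i) (r i) u) (c i)
  have h3 := dist_triangle (pp (c i) (r i) u) (pp (c j) (r j) t) (c i)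
  have h4 := dist_triangle (pp (c i) (r i) u) y (pp (c j) (r j) t)
  rw [dist_comm (pp (c i) (r i) u) y] at h4
  rw [dist_comm (pp (c i) (r i) u) (pp (c j) (r j) t)] at h3 h4
  have h5 : dist (pp (c j) (r j) t) (c i) - r i ≤ 2 * δ := by linarith
  have h6 : -(2 * δ) ≤ dist (pp (c j) (r j) t) (c i) - r i := by linarith
  have h7 : 0 ≤ dist (pp (c j) (r j) t) (c i) := dist_nonneg
  rw [e]
  have := hr i
  have := hr2 i
  generalize dist (pp (c j) (r j) t) (c i) = D at *
  have h8 : D ^ 2 - r i ^ 2 = (D - r i) * (D + r i) := by ring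
  rw [h8, abs_mul, abs_of_nonneg (by linarith : 0 ≤ D + r i)]
  have h9 : |D - r i| ≤ 2 * δ := abs_le.2 ⟨h6, h5⟩
  calc |D - r i| * (D + r i) ≤ (2 * δ) * 6 := by
        apply mul_le_mul h9 (by linarith) (by linarith) (by linarith)
    _ = _ := by ring

open Classical in
set_option maxHeartbeats 1000000 in
lemma discrete_bound : ∃ K : ℝ, 0 < K ∧ ∀ (F : Finset E2) (N : ℕ) (_ : 0 < N) (ρ : E2 → ℝ) (U : Set E2),
    (∀ x ∈ F, 1 ≤ ρ x) → (∀ x ∈ F, ρ x ≤ 2) →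
    (∀ x ∈ F, ∀ y ∈ F, x ≠ y → 1 / (N:ℝ) ≤ dist x y) → (∀ x ∈ F, ∀ y ∈ F, dist x y ≤ 1) →
    MeasurableSet U →
    (∀ x ∈ F, ∀ p, dist p x = ρ x → ball p (1 / (N:ℝ)) ⊆ U) →
    F.card * volume (ball (0 : E2) (1 / (N:ℝ))) ≤ ENNReal.ofReal (6 * K) * volume U := by
  obtain ⟨K, hK, hcomb⟩ := comb
  refine ⟨K, hK, ?_⟩
  intro F N hN ρ U hρ1 hρ2 hsep hdiam hU hUb
  have hNr : (0:ℝ) < N := by exact_mod_cast hN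
  have hN1 : (1:ℝ) ≤ N := by exact_mod_cast hN
  set δ : ℝ := 1 / (N:ℝ) with hδ
  have hδ0 : 0 < δ := by positivity
  have hδ1 : δ ≤ 1 := by rw [hδ, div_le_one hNr]; exact hN1
  let ι := {x // x ∈ F}
  let c : ι → E2 := fun i => i.1
  let r : ι → ℝ := fun i => ρ i.1
  have hr : ∀ i, 1 ≤ r i := fun i => hρ1 _ i.2
  have hr2 : ∀ i, r i ≤ 2 := fun i => hρ2 _ i.2
  have hD2 : ∀ j i : ι, D2 (fun i => c i 0) (fun i => c i 1) j i = dist (c i) (c j) ^ 2 := by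
    intro j i; rw [dist_sq]; rfl
  have hc := hcomb ι N hN (fun i => c i 0) (fun i => c i 1) r hr
    (by
      intro j i hji
      rw [hD2]
      have : i.1 ≠ j.1 := fun h => hji (Subtype.ext h.symm)
      have := hsep _ i.2 _ j.2 this
      gcongr)
    (by
      intro j i
      rw [hD2]
      exact pow_le_one₀ dist_nonneg (hdiam _ i.2 _ j.2))
    (by
      intro R hR j
      have hR0 : 0 ≤ R := hδ0.le.trans hR
      have := packing ((Finset.univ.filter (fun i : ι => D2 (fun i => c i 0) (fun i => c i 1) j i ≤ R ^ 2)).image c)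
        δ R hδ0 hR (by
          intro x hx y hy hxy
          simp only [Finset.mem_image] at hx hy
          obtain ⟨i, _, rfl⟩ := hx
          obtain ⟨k, _, rfl⟩ := hy
          exact hsep _ i.2 _ k.2 hxy) (c j) (by
          intro x hx
          simp only [Finset.mem_image, Finset.mem_filter, Finset.mem_univ, true_and] at hx
          obtain ⟨i, hi, rfl⟩ := hx
          rw [hD2] at hi
          exact le_of_sq_le_sq hi hR0)
      rw [Finset.card_image_of_injective _ Subtype.val_injective] at this
      have e : R / δ = R * N := by rw [hδ]; field_simp
      rwa [e] at this)
  set m : ι × ℕ → ℝ := fun p => ((Finset.univ.filter (fun i : ι =>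
    |Fn (fun i => c i 0) (fun i => c i 1) r p.1 i (p.2 / N)| ≤ 12 * (1 / N))).card : ℝ) with hm
  set A := (Finset.univ : Finset ι) ×ˢ Finset.range N with hA
  set good := A.filter (fun p => ¬ K * N ≤ m p) with hgood
  have hgc : (F.card : ℝ) * N / 2 ≤ good.card := by
    have h1 := Finset.card_filter_add_card_filter_not (s := A) (fun p => K * N ≤ m p)
    have h2 : (A.card : ℝ) = F.card * N := by
      rw [hA, Finset.card_product, Finset.card_range, Finset.card_univ, Fintype.card_coe]; push_cast; rfl
    have h3 : (((A.filter (fun p => K * N ≤ m p)).card : ℝ)) + good.card = A.card := by exact_mod_cast h1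
    have h4 : (((A.filter (fun p => K * N ≤ m p)).card : ℝ)) ≤ Fintype.card ι * N / 2 := hc
    rw [Fintype.card_coe] at h4
    linarith
  let Bl : ι × ℕ → Set E2 := fun p => ball (pp (c p.1) (r p.1) (p.2 / N)) δ
  have hBlU : ∀ p, Bl p ⊆ U := fun p => hUb _ p.1.2 _ (pp_dist _ (by linarith [hr p.1]) _)
  -- multiplicity
  have hmult : ∀ y, ((good.filter (fun p => y ∈ Bl p)).card : ℝ) ≤ 3 * K * N := by
    intro y
    rcases (good.filter (fun p => y ∈ Bl p)).eq_empty_or_nonempty with h0 | ⟨⟨j0, n0⟩, h0⟩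
    · rw [h0]; simp; positivity
    rw [Finset.mem_filter] at h0
    obtain ⟨h0, hy0⟩ := h0
    have h0' := (Finset.mem_filter.1 h0).2
    have key := card_le_of_fiber (good.filter (fun p => y ∈ Bl p)) (Finset.univ.filter (fun i : ι =>
      |Fn (fun i => c i 0) (fun i => c i 1) r j0 i (n0 / N)| ≤ 12 * (1 / N))) (fun p => p.1) (by
        rintro ⟨i, n⟩ hp
        simp only [Finset.mem_filter, Finset.mem_univ, true_and] at hp ⊢
        exact Fn_small c r hr hr2 hδ0 hδ1 j0 i _ _ y hy0 hp.2) 3 (by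
        intro i _
        set Z := (good.filter (fun p => y ∈ Bl p)).filter (fun p => p.1 = i) with hZ
        have hZ1 : (Z.image (fun p => p.2)).card = Z.card := by
          apply Finset.card_image_of_injOn
          rintro ⟨a, n⟩ ha ⟨b, m⟩ hb hab
          simp only [hZ, Finset.coe_filter, Set.mem_ofPred_eq] at ha hb
          simp only at hab
          rw [Prod.mk.injEq]
          exact ⟨ha.2.trans hb.2.symm, hab⟩
        rw [← hZ1]
        have hin : ∀ n ∈ Z.image (fun p => p.2), n < N ∧ y ∈ Bl (i, n) := by
          intro n hn
          simp only [hZ, Finset.mem_image, Finset.mem_filter, hgood, hA, Finset.mem_product, Finset.mem_range] at hn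
          obtain ⟨⟨a, n'⟩, ⟨⟨h1, h2⟩, h3⟩, h4⟩ := hn
          simp only at h3 h4
          subst h3 h4
          exact ⟨h1.1.2, h2⟩
        refine (card_le_of_diam _ 2 (by norm_num) ?_).trans (by norm_num)
        intro n hn m' hm'
        obtain ⟨a1, a2⟩ := hin n hn
        obtain ⟨b1, b2⟩ := hin m' hm'
        have a1' : (n:ℝ) ≤ N := by exact_mod_cast a1.le
        have b1' : (m':ℝ) ≤ N := by exact_mod_cast b1.le
        have h1 := pp_sep (c i) (t := n / N) (u := m' / N) (hr i) (by positivity)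
          (by rw [div_le_one hNr]; exact a1') (by positivity) (by rw [div_le_one hNr]; exact b1')
        have h2 := dist_triangle_left (pp (c i) (r i) (n / N)) (pp (c i) (r i) (m' / N)) y
        simp only [Bl, mem_ball] at a2 b2
        have h3 : |(n:ℝ) / N - m' / N| ≤ 2 * δ := by linarith
        have h4 : (n:ℝ) - m' = ((n:ℝ) / N - m' / N) * N := by field_simp
        rw [h4, abs_mul, abs_of_pos hNr]
        calc _ ≤ 2 * δ * N := by gcongr
          _ = 2 := by rw [hδ]; field_simp)
    refine key.trans ?_
    have : m (j0, n0) ≤ K * N := (not_le.1 h0').le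
    simp only [hm] at this
    linarith
  -- integrate
  have hintegral : (good.card : ℝ≥0∞) * volume (ball (0 : E2) δ) ≤ ENNReal.ofReal (3 * K * N) * volume U := by
    calc (good.card : ℝ≥0∞) * volume (ball (0 : E2) δ)
        = ∑ p ∈ good, volume (Bl p) := by
          simp only [Bl, Measure.addHaar_ball_center, Finset.sum_const, nsmul_eq_mul]
      _ = ∑ p ∈ good, ∫⁻ y, (Bl p).indicator 1 y := by
          refine Finset.sum_congr rfl fun p _ => ?_
          rw [lintegral_indicator_one measurableSet_ball]
      _ = ∫⁻ y, ∑ p ∈ good, (Bl p).indicator 1 y := by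
          rw [lintegral_finsetSum]
          intro p _
          exact measurable_one.indicator measurableSet_ball
      _ ≤ ∫⁻ y, U.indicator (fun _ => ENNReal.ofReal (3 * K * N)) y := by
          apply lintegral_mono
          intro y
          by_cases hy : y ∈ U
          · simp only [Set.indicator_of_mem hy]
            have : ∑ p ∈ good, (Bl p).indicator (1 : E2 → ℝ≥0∞) y = ((good.filter (fun p => y ∈ Bl p)).card : ℝ≥0∞) := by
              simp [Set.indicator_apply, Finset.sum_boole]
            rw [this, ← ENNReal.ofReal_natCast]
            exact ENNReal.ofReal_le_ofReal (hmult y)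
          · have : ∀ p ∈ good, (Bl p).indicator (1 : E2 → ℝ≥0∞) y = 0 := by
              intro p _
              exact Set.indicator_of_notMem (fun h => hy (hBlU p h)) _
            refine le_trans (le_of_eq (Finset.sum_eq_zero this)) zero_le
      _ = _ := by rw [lintegral_indicator hU, lintegral_const]; simp
  have h1 : ENNReal.ofReal ((N:ℝ) / 2) * (F.card * volume (ball (0 : E2) δ)) ≤
      ENNReal.ofReal ((N:ℝ) / 2) * (ENNReal.ofReal (6 * K) * volume U) := by
    calc _ = ENNReal.ofReal (F.card * N / 2) * volume (ball (0 : E2) δ) := by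
          rw [← mul_assoc, ← ENNReal.ofReal_natCast F.card, ← ENNReal.ofReal_mul (by positivity)]
          congr 2; ring
      _ ≤ ENNReal.ofReal (good.card) * volume (ball (0 : E2) δ) := by
          gcongr
      _ = (good.card : ℝ≥0∞) * volume (ball (0 : E2) δ) := by rw [ENNReal.ofReal_natCast]
      _ ≤ _ := hintegral
      _ = _ := by
          rw [← mul_assoc, ← ENNReal.ofReal_mul (by positivity)]
          congr 2; ring
  rwa [ENNReal.mul_le_mul_iff_right (by simp; positivity) ENNReal.ofReal_ne_top] at h1
end

section
open scoped ENNReal Pointwise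

lemma unit_scale (S B : Set E2) (hB0 : volume B = 0)
    (hS : ∀ x ∈ S, ∃ r : ℝ, 1 ≤ r ∧ r ≤ 2 ∧ sphere x r ⊆ B)
    (hdiam : ∀ x ∈ S, ∀ y ∈ S, dist x y ≤ 1) : volume S = 0 := by
  classical
  obtain ⟨K, hK, hdisc⟩ := discrete_bound
  have hS' : ∀ x, ∃ r : ℝ, x ∈ S → 1 ≤ r ∧ r ≤ 2 ∧ sphere x r ⊆ B := by
    intro x
    by_cases hx : x ∈ S
    · obtain ⟨r, hr⟩ := hS x hx
      exact ⟨r, fun _ => hr⟩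
    · exact ⟨0, fun h => absurd h hx⟩
  choose ρ hρ using hS'
  have main : ∀ U : Set E2, IsOpen U → B ⊆ U → volume S ≤ ENNReal.ofReal (6 * K) * volume U := by
    intro U hU hBU
    let Sn : ℕ → Set E2 := fun n => {x | x ∈ S ∧ thickening (1 / ((n:ℝ) + 1)) (sphere x (ρ x)) ⊆ U}
    have hmono : Monotone Sn := by
      intro n m hnm x hx
      refine ⟨hx.1, Set.Subset.trans (thickening_mono ?_ _) hx.2⟩
      have : (n:ℝ) ≤ m := by exact_mod_cast hnm
      gcongr
    have hun : S = ⋃ n, Sn n := by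
      ext x
      simp only [Set.mem_iUnion]
      constructor
      · intro hx
        obtain ⟨ε, hε, h⟩ := (isCompact_sphere x (ρ x)).exists_thickening_subset_open hU
          ((hρ x hx).2.2.trans hBU)
        obtain ⟨n, hn⟩ := exists_nat_one_div_lt hε
        exact ⟨n, hx, Set.Subset.trans (thickening_mono hn.le _) h⟩
      · rintro ⟨n, hx⟩
        exact hx.1
    rw [hun, hmono.measure_iUnion]
    refine iSup_le fun n => ?_
    set N := n + 1 with hN
    have hNr : (0:ℝ) < N := by rw [hN]; positivity
    have hNe : ((n:ℝ) + 1) = N := by rw [hN]; push_cast; rfl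
    let P : Finset E2 → Prop := fun F => (∀ x ∈ F, x ∈ Sn n) ∧
      ∀ x ∈ F, ∀ y ∈ F, x ≠ y → 1 / (N:ℝ) ≤ dist x y
    have hbd : ∀ F, P F → F.card ≤ ⌊9 * (1 / (1 / (N:ℝ))) ^ 2⌋₊ := by
      intro F hF
      apply Nat.le_floor
      rcases F.eq_empty_or_nonempty with h | ⟨x0, hx0⟩
      · rw [h]; simp
      refine packing F (1 / N) 1 (by positivity) ?_ hF.2 x0 (fun x hx => hdiam _ (hF.1 x hx).1 _ (hF.1 x0 hx0).1)
      rw [div_le_one hNr]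
      rw [hN]; push_cast; linarith [(Nat.cast_nonneg n : (0:ℝ) ≤ n)]
    have hmax : ∃ F, P F ∧ ∀ G, P G → G.card ≤ F.card := by
      let V : Set ℕ := {k | ∃ F, P F ∧ F.card = k}
      have hV : V.Nonempty := ⟨0, ∅, ⟨by simp, by simp⟩, rfl⟩
      have hVb : BddAbove V := ⟨_, by rintro k ⟨F, hF, rfl⟩; exact hbd F hF⟩
      obtain ⟨F, hF, hFc⟩ := Nat.sSup_mem hV hVb
      refine ⟨F, hF, fun G hG => ?_⟩
      rw [hFc]
      exact le_csSup hVb ⟨G, hG, rfl⟩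
    obtain ⟨F, hF, hFm⟩ := hmax
    have hcov : Sn n ⊆ ⋃ x ∈ F, ball x (1 / (N:ℝ)) := by
      intro y hy
      by_contra hcon
      simp only [Set.mem_iUnion, mem_ball, not_exists, not_lt] at hcon
      have hyF : y ∉ F := by
        intro h
        have := hcon y h
        rw [dist_self] at this
        have : 0 < 1 / (N:ℝ) := by positivity
        linarith
      have := hFm (insert y F) ⟨by
        intro x hx
        rcases Finset.mem_insert.1 hx with rfl | hx
        · exact hy
        · exact hF.1 x hx, by
        intro x hx z hz hxz
        rcases Finset.mem_insert.1 hx with hx | hx <;> rcases Finset.mem_insert.1 hz with hz | hz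
        · exact absurd (hx.trans hz.symm) hxz
        · rw [hx]; exact hcon z hz
        · rw [hz, dist_comm]; exact hcon x hx
        · exact hF.2 x hx z hz hxz⟩
      rw [Finset.card_insert_of_notMem hyF] at this
      omega
    calc volume (Sn n) ≤ volume (⋃ x ∈ F, ball x (1 / (N:ℝ))) := measure_mono hcov
      _ ≤ ∑ x ∈ F, volume (ball x (1 / (N:ℝ))) := measure_biUnion_finset_le _ _
      _ = F.card * volume (ball (0 : E2) (1 / (N:ℝ))) := by
          simp only [Measure.addHaar_ball_center, Finset.sum_const, nsmul_eq_mul]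
      _ ≤ _ := by
          refine hdisc F N (by omega) ρ U (fun x hx => (hρ x (hF.1 x hx).1).1)
            (fun x hx => (hρ x (hF.1 x hx).1).2.1) hF.2
            (fun x hx y hy => hdiam _ (hF.1 x hx).1 _ (hF.1 y hy).1) hU.measurableSet ?_
          intro x hx p hp
          refine Set.Subset.trans ?_ (hF.1 x hx).2
          rw [hNe]
          exact ball_subset_thickening (by rw [mem_sphere]; exact hp) _
  by_contra hne
  have hC0 : ENNReal.ofReal (6 * K) ≠ 0 := by
    rw [Ne, ENNReal.ofReal_eq_zero, not_le]; positivity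
  have hpos : 0 < volume S / ENNReal.ofReal (6 * K) := ENNReal.div_pos hne ENNReal.ofReal_ne_top
  obtain ⟨U, hBU, hUo, hUv⟩ := Set.exists_isOpen_lt_of_lt B _ (by rw [hB0]; exact hpos)
  have h1 := main U hUo hBU
  have h2 := ENNReal.mul_lt_of_lt_div' hUv
  exact absurd h1 (not_le.2 h2)

lemma all_scales (S B : Set E2) (hB0 : volume B = 0)
    (hS : ∀ x ∈ S, ∃ r > (0:ℝ), sphere x r ⊆ B) : volume S = 0 := by
  let Pc : ℤ × ℕ → Set E2 := fun q => {x | x ∈ S ∧ (∃ r : ℝ, (2:ℝ) ^ q.1 ≤ r ∧ r ≤ 2 ^ (q.1 + 1) ∧ sphere x r ⊆ B) ∧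
    dist x (TopologicalSpace.denseSeq E2 q.2) < (2:ℝ) ^ q.1 / 2}
  have hcov : S ⊆ ⋃ q, Pc q := by
    intro x hx
    obtain ⟨r, hr, hrB⟩ := hS x hx
    obtain ⟨n, hn⟩ := exists_mem_Ico_zpow hr (one_lt_two : (1:ℝ) < 2)
    obtain ⟨k, hk⟩ := (TopologicalSpace.denseRange_denseSeq E2).exists_dist_lt x
      (show (0:ℝ) < (2:ℝ) ^ n / 2 by positivity)
    exact Set.mem_iUnion.2 ⟨(n, k), hx, ⟨r, hn.1, hn.2.le, hrB⟩, hk⟩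
  refine measure_mono_null hcov (measure_iUnion_null fun q => ?_)
  obtain ⟨n, k⟩ := q
  set c : ℝ := (2:ℝ) ^ (-n) with hc
  have hc0 : 0 < c := by positivity
  have hcn : c * 2 ^ n = 1 := by
    rw [hc, ← zpow_add₀ two_ne_zero]; simp
  have h1 : volume (c • Pc (n, k)) = 0 := by
    apply unit_scale _ (c • B)
    · rw [Measure.addHaar_smul, hB0, mul_zero]
    · rintro _ ⟨x, hx, rfl⟩
      obtain ⟨_, ⟨r, hr1, hr2, hrB⟩, _⟩ := hx
      simp only at hr1 hr2
      refine ⟨c * r, ?_, ?_, ?_⟩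
      · rw [← hcn]; gcongr
      · have : c * r ≤ c * 2 ^ (n + 1) := by gcongr
        rw [zpow_add₀ two_ne_zero, ← mul_assoc, hcn] at this
        simpa using this
      · have := smul_sphere' hc0.ne' x r
        rw [Real.norm_of_nonneg hc0.le] at this
        change sphere (c • x) (c * r) ⊆ c • B
        rw [← this]
        exact Set.smul_set_mono hrB
    · rintro _ ⟨x, hx, rfl⟩ _ ⟨y, hy, rfl⟩
      have h2 := hx.2.2
      have h3 := hy.2.2
      simp only at h2 h3
      have h4 := dist_triangle_right x y (TopologicalSpace.denseSeq E2 k)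
      change dist (c • x) (c • y) ≤ 1
      rw [dist_smul₀, Real.norm_of_nonneg hc0.le, ← hcn]
      gcongr
      linarith
  rw [Measure.addHaar_smul] at h1
  rcases mul_eq_zero.1 h1 with h | h
  · rw [ENNReal.ofReal_eq_zero] at h
    exact absurd h (not_le.2 (by positivity))
  · exact h
end

end BM

/-- **Bourgain–Marstrand theorem.** If `S ⊆ ℝ²` has positive Lebesgue outer measure and
`B` contains a circle centered at every point of `S`, then `B` has positive Lebesgue
outer measure. -/
theorem bourgain_marstrand_circles
    (S B : Set (EuclideanSpace ℝ (Fin 2)))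
    (hS : 0 < volume S)
    (hB : ∀ x ∈ S, ∃ r > (0 : ℝ), Metric.sphere x r ⊆ B) :
    0 < volume B := by
  rw [pos_iff_ne_zero]
  intro h0
  exact hS.ne' (BM.all_scales S B h0 hB)
end
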